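/- arXiv:1906.01481 — 9 statements merged into one kernel-verified Lean document; each statement's English description precedes it below -/
import Mathlib

section
/- Let n ≥ 1 and let p_1, …, p_n ∈ (0,1] with τ := Σ_{i=1}^n p_i ≥ 1. Then there exists a partition of {1,…,n} into t nonempty groups such that Σ_{i ∈ G} p_i ≤ 1 for every group G, and moreover: if τ is an integer then t ≤ 2τ − 1, and if τ is not an integer then t < 2τ + 1. -/
/-- Lemma 1 of the paper: existence of a group partition of `{1,…,n}`
with prescribed marginals `p i ∈ (0,1]` such that every group has `p`-mass at most one,
and the number of groups `t` satisfies `t ≤ 2τ − 1` if `τ = Σ p i` is an integer and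
`t < 2τ + 1` otherwise. -/
theorem exists_group_partition
    {n : ℕ} (hn : 1 ≤ n) (p : Fin n → ℝ)
    (hp0 : ∀ i, 0 < p i) (hp1 : ∀ i, p i ≤ 1)
    (hτ : 1 ≤ ∑ i, p i) :
    ∃ (t : ℕ) (G : Fin t → Finset (Fin n)),
      (∀ j, (G j).Nonempty) ∧
      (∀ j k, j ≠ k → Disjoint (G j) (G k)) ∧
      (∀ i : Fin n, ∃ j, i ∈ G j) ∧
      (∀ j, ∑ i ∈ G j, p i ≤ 1) ∧
      ((∃ m : ℤ, ∑ i, p i = (m : ℝ)) → (t : ℝ) ≤ 2 * (∑ i, p i) - 1) ∧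
      (¬ (∃ m : ℤ, ∑ i, p i = (m : ℝ)) → (t : ℝ) < 2 * (∑ i, p i) + 1) := by
  classical
  -- colourings with all fibres of mass at most one
  let P : ℕ → Prop := fun c => ∃ f : Fin n → Fin n,
    (∀ j, ∑ i with f i = j, p i ≤ 1) ∧ (Finset.univ.image f).card = c
  have hex : ∃ c, P c := by
    refine ⟨_, id, ?_, rfl⟩
    intro j
    have : (Finset.univ.filter fun i : Fin n => id i = j) = {j} := by ext; simp
    rw [this]; simpa using hp1 j
  obtain ⟨f, hf, hc⟩ := Nat.find_spec hex
  have hmin : ∀ g : Fin n → Fin n, (∀ j, ∑ i with g i = j, p i ≤ 1) →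
      (Finset.univ.image f).card ≤ (Finset.univ.image g).card := by
    intro g hg
    rw [hc]
    exact Nat.find_min' hex ⟨g, hg, rfl⟩
  set S := Finset.univ.image f with hS
  let a : Fin n → ℝ := fun j => ∑ i with f i = j, p i
  have hpair : ∀ j ∈ S, ∀ k ∈ S, k ≠ j → 1 < a j + a k := by
    intro j hj k hk hkj
    by_contra hcon
    push Not at hcon
    have h := hmin (fun i => if f i = j then k else f i) ?_
    · have hsub : Finset.univ.image (fun i => if f i = j then k else f i) ⊆ S.erase j := by
        intro x hx
        simp only [Finset.mem_image, Finset.mem_univ, true_and] at hx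
        obtain ⟨i, rfl⟩ := hx
        split_ifs with h1
        · exact Finset.mem_erase.2 ⟨hkj, hk⟩
        · exact Finset.mem_erase.2 ⟨h1, Finset.mem_image_of_mem _ (Finset.mem_univ _)⟩
      have h2 := Finset.card_le_card hsub
      have h3 := Finset.card_erase_lt_of_mem hj
      omega
    · intro l
      by_cases hl : l = k
      · subst hl
        refine le_trans (le_of_eq ?_) hcon
        simp only [a, Finset.sum_filter]
        rw [← Finset.sum_add_distrib]
        refine Finset.sum_congr rfl fun i _ => ?_
        by_cases h1 : f i = j
        · simp [h1, hkj.symm]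
        · simp [h1]
      · refine le_trans (Finset.sum_le_sum_of_subset_of_nonneg ?_ fun i _ _ => (hp0 i).le) (hf l)
        intro i hi
        simp only [Finset.mem_filter, Finset.mem_univ, true_and] at hi ⊢
        split_ifs at hi with h1
        · exact absurd hi.symm hl
        · exact hi
  have hsum : ∑ j ∈ S, a j = ∑ i, p i :=
    Finset.sum_fiberwise_of_maps_to (fun i hi => Finset.mem_image_of_mem f hi) p
  set τ := ∑ i, p i with hτd
  have key : S.card = 1 ∨ (S.card : ℝ) < 2 * τ := by
    have hSne : S.Nonempty := ⟨f ⟨0, hn⟩, Finset.mem_image_of_mem _ (Finset.mem_univ _)⟩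
    have hpos := hSne.card_pos
    by_cases h1 : S.card = 1
    · exact Or.inl h1
    right
    have h2 : (1:ℝ) < S.card := by
      have : 1 < S.card := by omega
      exact_mod_cast this
    have hj : ∀ j ∈ S, (S.card : ℝ) - 1 < (S.card - 2) * a j + τ := by
      intro j hj
      have hcard : ((S.erase j).card : ℝ) = S.card - 1 := by
        rw [Finset.card_erase_of_mem hj, Nat.cast_sub hpos]; simp
      have hne : (S.erase j).Nonempty := by
        rw [← Finset.card_pos, Finset.card_erase_of_mem hj]; omega
      have h3 : ∑ k ∈ S.erase j, (1:ℝ) < ∑ k ∈ S.erase j, (a j + a k) :=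
        Finset.sum_lt_sum_of_nonempty hne fun k hk =>
          hpair j hj k (Finset.mem_of_mem_erase hk) (Finset.ne_of_mem_erase hk)
      have h4 := Finset.add_sum_erase S a hj
      rw [Finset.sum_add_distrib, Finset.sum_const, Finset.sum_const, nsmul_eq_mul, nsmul_eq_mul,
        hcard] at h3
      linarith
    have h5 := Finset.sum_lt_sum_of_nonempty hSne hj
    rw [Finset.sum_add_distrib, ← Finset.mul_sum, hsum, Finset.sum_const, Finset.sum_const,
      nsmul_eq_mul, nsmul_eq_mul] at h5
    by_contra hcon
    push Not at hcon
    nlinarith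
  let e := S.equivFin
  refine ⟨S.card, fun j => Finset.univ.filter fun i => f i = (e.symm j : Fin n),
    ?_, ?_, ?_, ?_, ?_, ?_⟩
  · intro j
    obtain ⟨i, -, hi⟩ := Finset.mem_image.1 (e.symm j).2
    exact ⟨i, by simpa using hi⟩
  · intro j k hjk
    rw [Finset.disjoint_left]
    intro i hi hi'
    simp only [Finset.mem_filter, Finset.mem_univ, true_and] at hi hi'
    exact hjk (e.symm.injective (Subtype.ext (hi.symm.trans hi')))
  · intro i
    refine ⟨e ⟨f i, Finset.mem_image_of_mem _ (Finset.mem_univ _)⟩, ?_⟩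
    simp
  · intro j
    exact hf _
  · rintro ⟨m, hm⟩
    rcases key with h | h
    · rw [h]; push_cast; linarith
    · rw [hm] at h ⊢
      have h' : (S.card : ℤ) < 2 * m := by exact_mod_cast h
      have h'' : (S.card : ℤ) ≤ 2 * m - 1 := by omega
      exact_mod_cast h''
  · intro _
    rcases key with h | h
    · rw [h]; push_cast; linarith
    · linarith
end

section
/- Under the setup below, with 0 < η ≤ 1/(6ℒ₁) and p ∈ (0,1], for any x, w ∈ ℝ^d the following one-step contraction holds: Σ_C p_C ‖x⁺_C − x*‖² + p·D(x) + (1−p)·D(w) ≤ (1 − ημ/(1+ημ_ψ)) ‖x − x*‖² + (1 − p/2) D(w), where for each subset C with p_C > 0, g_C := (1/n) Σ_{i∈C} θ^i_C (∇f_i(x) − ∇f_i(w)) + ∇f(w), x⁺_C is a minimizer over ℝ^d of y ↦ (1/(2η))‖x − η g_C − y‖² + ψ(y), and D(u) := (4η²/(p(1+ημ_ψ))) · E_S ‖(1/n) Σ_{i∈S} θ^i_S (∇f_i(u) − ∇f_i(x*))‖². -/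
open scoped RealInnerProductSpace BigOperators


theorem aux_min {E : Type*} [NormedAddCommGroup E] [NormedSpace ℝ E]
    (h F : E → ℝ) (u : E) (L : E →L[ℝ] ℝ) (hh : ConvexOn ℝ Set.univ h)
    (hF : HasFDerivAt F L u) (hmin : ∀ y, h u + F u ≤ h y + F y) (y : E) :
    h u ≤ h y + L (y - u) := by
  have hl : HasDerivAt (fun t : ℝ => u + t • (y - u)) (y - u) 0 := by
    simpa using ((hasDerivAt_id (0 : ℝ)).smul_const (y - u)).const_add u
  have hF' : HasFDerivAt F L (u + (0 : ℝ) • (y - u)) := by simpa using hF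
  have hd := hF'.comp_hasDerivAt (0 : ℝ) hl
  have ht := hd.tendsto_slope_zero_right
  have : h u - h y ≤ L (y - u) := by
    refine ge_of_tendsto ht ?_
    have hmem : Set.Ioc (0 : ℝ) 1 ∈ nhdsWithin (0 : ℝ) (Set.Ioi 0) :=
      Ioc_mem_nhdsGT one_pos
    filter_upwards [hmem] with t ht
    have h1 := hmin (u + t • (y - u))
    have h2 := hh.2 (Set.mem_univ u) (Set.mem_univ y) (sub_nonneg.2 ht.2) ht.1.le (by ring)
    have h3 : (1 - t) • u + t • y = u + t • (y - u) := by
      rw [sub_smul, smul_sub, one_smul]; abel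
    rw [h3] at h2
    simp only [smul_eq_mul, Function.comp, zero_add, zero_smul, add_zero] at h2 ⊢
    have h4 : h u - h y = t⁻¹ * (t * (h u - h y)) := by
      field_simp [ht.1.ne']
    rw [h4]
    refine mul_le_mul_of_nonneg_left ?_ (inv_nonneg.2 ht.1.le)
    linarith
  linarith

theorem aux_prox {E : Type*} [NormedAddCommGroup E] [InnerProductSpace ℝ E]
    (u v : E) (c : ℝ) (hc : 0 ≤ c)
    (h : (1 + c) * ‖u‖ ^ 2 ≤ ⟪v, u⟫) : (1 + c) * ‖u‖ ^ 2 ≤ ‖v‖ ^ 2 := by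
  have h1 := norm_sub_sq_real v u
  have h2 := sq_nonneg ‖v - u‖
  nlinarith [mul_nonneg hc (sq_nonneg ‖u‖)]

/-- Theorem 1 of the paper: one-step contraction for loopless SVRG with
arbitrary (unbiased) sampling in the strongly convex composite case. -/
theorem lsvrg_strongly_convex_one_step
    {d n : ℕ}
    (f : Fin n → EuclideanSpace ℝ (Fin d) → ℝ)
    (f' : Fin n → EuclideanSpace ℝ (Fin d) → EuclideanSpace ℝ (Fin d))
    (hgrad : ∀ i x, HasGradientAt (f i) (f' i x) x)
    -- `fbar` is the average function f and `fgrad` its gradient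
    (fbar : EuclideanSpace ℝ (Fin d) → ℝ)
    (hfbar : ∀ u, fbar u = (n : ℝ)⁻¹ * ∑ i, f i u)
    (fgrad : EuclideanSpace ℝ (Fin d) → EuclideanSpace ℝ (Fin d))
    (hfgrad : ∀ u, fgrad u = (n : ℝ)⁻¹ • ∑ i, f' i u)
    (μf μψ : ℝ) (hμf : 0 ≤ μf) (hμψ : 0 ≤ μψ) (hμ : 0 < μf + μψ)
    (hfconv : ConvexOn ℝ Set.univ fbar)
    (hfsc : ConvexOn ℝ Set.univ (fun u => fbar u - μf / 2 * ‖u‖ ^ 2))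
    (ψ : EuclideanSpace ℝ (Fin d) → ℝ)
    (hψconv : ConvexOn ℝ Set.univ ψ)
    (hψsc : ConvexOn ℝ Set.univ (fun u => ψ u - μψ / 2 * ‖u‖ ^ 2))
    -- minimizer of P = f + ψ
    (xstar : EuclideanSpace ℝ (Fin d))
    (hxstar : ∀ u, fbar xstar + ψ xstar ≤ fbar u + ψ u)
    -- the sampling and its weights, unbiased
    (pC : Finset (Fin n) → ℝ) (hpC : ∀ C, 0 ≤ pC C) (hpCsum : ∑ C, pC C = 1)
    (θ : Finset (Fin n) → Fin n → ℝ)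
    (hunbias : ∀ i, ∑ C ∈ Finset.univ.filter (fun C => i ∈ C), pC C * θ C i = 1)
    -- expected smoothness
    (L1 : ℝ) (hL1 : 0 < L1)
    (hES : ∀ u, ∑ C, pC C * ‖(n : ℝ)⁻¹ • ∑ i ∈ C, θ C i • (f' i u - f' i xstar)‖ ^ 2
        ≤ 2 * L1 * (fbar u - fbar xstar - ⟪fgrad xstar, u - xstar⟫))
    -- stepsize and probability
    (η p : ℝ) (hη : 0 < η) (hη' : η ≤ 1 / (6 * L1)) (hp : 0 < p) (hp' : p ≤ 1)
    (x w : EuclideanSpace ℝ (Fin d))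
    -- the stochastic gradient estimator
    (g : Finset (Fin n) → EuclideanSpace ℝ (Fin d))
    (hg : ∀ C, g C = (n : ℝ)⁻¹ • ∑ i ∈ C, θ C i • (f' i x - f' i w) + fgrad w)
    -- the proximal step: for every C with positive probability, x⁺_C minimizes the prox objective
    (xplus : Finset (Fin n) → EuclideanSpace ℝ (Fin d))
    (hxplus : ∀ C, 0 < pC C → ∀ u,
      1 / (2 * η) * ‖x - η • g C - xplus C‖ ^ 2 + ψ (xplus C)
        ≤ 1 / (2 * η) * ‖x - η • g C - u‖ ^ 2 + ψ u)
    -- the Lyapunov term D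
    (D : EuclideanSpace ℝ (Fin d) → ℝ)
    (hD : ∀ u, D u = 4 * η ^ 2 / (p * (1 + η * μψ)) *
        ∑ C, pC C * ‖(n : ℝ)⁻¹ • ∑ i ∈ C, θ C i • (f' i u - f' i xstar)‖ ^ 2) :
    ∑ C, pC C * ‖xplus C - xstar‖ ^ 2 + p * D x + (1 - p) * D w
      ≤ (1 - η * (μf + μψ) / (1 + η * μψ)) * ‖x - xstar‖ ^ 2 + (1 - p / 2) * D w := by
  have hn2 : ∀ u : EuclideanSpace ℝ (Fin d),
      HasFDerivAt (fun y : EuclideanSpace ℝ (Fin d) => ‖y‖ ^ 2) (2 • (innerSL ℝ u)) u :=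
    fun u => (hasStrictFDerivAt_norm_sq u).hasFDerivAt
  have hfb : ∀ u, HasFDerivAt fbar (innerSL ℝ (fgrad u)) u := by
    intro u
    have h1 : HasFDerivAt (fun y => (n : ℝ)⁻¹ * ∑ i, f i y)
        ((n : ℝ)⁻¹ • ∑ i, innerSL ℝ (f' i u)) u := by
      refine HasFDerivAt.const_mul (HasFDerivAt.fun_sum fun i _ => ?_) _
      exact (hgrad i u).hasFDerivAt
    have h2 : fbar = fun y => (n : ℝ)⁻¹ * ∑ i, f i y := funext hfbar
    rw [h2, hfgrad u, map_smul, map_sum]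
    exact h1
  have hpol : ∀ u y : EuclideanSpace ℝ (Fin d),
      ‖y‖ ^ 2 = ‖u‖ ^ 2 + 2 * ⟪u, y - u⟫ + ‖y - u‖ ^ 2 := by
    intro u y
    have := norm_add_sq_real u (y - u)
    rwa [add_sub_cancel] at this
  -- strong convexity of fbar
  have hfs : ∀ u y, fbar u + ⟪fgrad u, y - u⟫ + μf / 2 * ‖y - u‖ ^ 2 ≤ fbar y := by
    intro u y
    have h := aux_min _ (fun y => μf / 2 * ‖y‖ ^ 2 - fbar y) u _ hfsc
      (((hn2 u).const_mul (μf / 2)).sub (hfb u)) (fun y => by simp) y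
    simp at h
    have := hpol u y
    nlinarith
  -- optimality of xstar
  have hxs : ∀ y, ψ xstar - ⟪fgrad xstar, y - xstar⟫ + μψ / 2 * ‖y - xstar‖ ^ 2 ≤ ψ y := by
    intro y
    have h := aux_min _ (fun y => μψ / 2 * ‖y‖ ^ 2 + fbar y) xstar _ hψsc
      (((hn2 xstar).const_mul (μψ / 2)).add (hfb xstar))
      (fun y => by have := hxstar y; linarith) y
    simp at h
    have := hpol xstar y
    nlinarith
  have hprox : ∀ C, 0 < pC C → ∀ y, ψ (xplus C) + 1 / η * ⟪x - η • g C - xplus C, y - xplus C⟫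
      + μψ / 2 * ‖y - xplus C‖ ^ 2 ≤ ψ y := by
    intro C hC y
    have hd : HasFDerivAt (fun y => ‖x - η • g C - y‖ ^ 2) _ (xplus C) :=
      ((hasFDerivAt_id (𝕜 := ℝ) (xplus C)).const_sub (x - η • g C)).norm_sq
    have h := aux_min _ (fun y => μψ / 2 * ‖y‖ ^ 2 + 1 / (2 * η) * ‖x - η • g C - y‖ ^ 2)
      (xplus C) _ hψsc (((hn2 (xplus C)).const_mul (μψ / 2)).add (hd.const_mul (1 / (2 * η))))
      (fun y => by have := hxplus C hC y; linarith) y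
    have h5 := hpol (xplus C) y
    have h6 : η⁻¹ * 2⁻¹ * (2 * ⟪x - η • g C - xplus C, y - xplus C⟫)
      = 1 / η * ⟪x - η • g C - xplus C, y - xplus C⟫ := by field_simp
    simp only [ContinuousLinearMap.add_apply, ContinuousLinearMap.smul_apply, innerSL_apply_apply,
      ContinuousLinearMap.comp_apply, ContinuousLinearMap.neg_apply, smul_eq_mul, nsmul_eq_mul,
      ContinuousLinearMap.id_apply, inner_neg_right, id, one_div, mul_inv] at h h6 ⊢
    push_cast at h
    nlinarith
  obtain ⟨A, hA⟩ : ∃ A : EuclideanSpace ℝ (Fin d) → Finset (Fin n) → EuclideanSpace ℝ (Fin d),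
      ∀ u C, A u C = (n : ℝ)⁻¹ • ∑ i ∈ C, θ C i • (f' i u - f' i xstar) := ⟨_, fun _ _ => rfl⟩
  simp only [← hA] at hES hD
  have hEA : ∀ u, ∑ C, pC C • A u C = fgrad u - fgrad xstar := by
    intro u
    rw [hfgrad, hfgrad, ← smul_sub, ← Finset.sum_sub_distrib]
    have h1 : ∀ C, pC C • A u C
        = (n : ℝ)⁻¹ • ∑ i, if i ∈ C then (pC C * θ C i) • (f' i u - f' i xstar) else 0 := by
      intro C
      rw [hA, smul_comm, Finset.smul_sum]
      congr 1
      rw [Finset.sum_ite_mem, Finset.univ_inter]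
      exact Finset.sum_congr rfl fun i _ => by rw [mul_smul]
    simp only [h1]
    rw [← Finset.smul_sum, Finset.sum_comm]
    congr 1
    refine Finset.sum_congr rfl fun i _ => ?_
    rw [← Finset.sum_filter, ← Finset.sum_smul, hunbias, one_smul]
  have hEi : ∀ u v, ∑ C, pC C * ⟪v, A u C⟫ = ⟪v, fgrad u - fgrad xstar⟫ := by
    intro u v
    rw [← hEA, inner_sum]
    exact Finset.sum_congr rfl fun C _ => by rw [inner_smul_right]
  obtain ⟨m, hm⟩ : ∃ m, m = fgrad w - fgrad xstar := ⟨_, rfl⟩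
  have hgA : ∀ C, g C - fgrad xstar = A x C - (A w C - m) := by
    intro C
    have h1 : (n : ℝ)⁻¹ • ∑ i ∈ C, θ C i • (f' i x - f' i w) = A x C - A w C := by
      rw [hA, hA, ← smul_sub, ← Finset.sum_sub_distrib]
      congr 1
      refine Finset.sum_congr rfl fun i _ => ?_
      rw [← smul_sub, sub_sub_sub_cancel_right]
    rw [hg, h1, hm]; abel
  obtain ⟨z, hz⟩ : ∃ z, z = x - xstar := ⟨_, rfl⟩
  have hc : 0 ≤ η * μψ := by positivity
  -- pointwise bound
  have hpt : ∀ C, pC C * ((1 + η * μψ) * ‖xplus C - xstar‖ ^ 2) ≤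
      pC C * (‖z‖ ^ 2 - 2 * η * (⟪z, A x C⟫ - ⟪z, A w C⟫ + ⟪z, m⟫)
        + η ^ 2 * (2 * ‖A x C‖ ^ 2 + 2 * ‖A w C‖ ^ 2 - 4 * ⟪m, A w C⟫ + 2 * ‖m‖ ^ 2)) := by
    intro C
    rcases (hpC C).eq_or_lt with h0 | h0
    · simp [← h0]
    refine mul_le_mul_of_nonneg_left ?_ h0.le
    have h1 := hprox C h0 xstar
    have h2 := hxs (xplus C)
    obtain ⟨δ, hδ⟩ : ∃ δ, δ = xplus C - xstar := ⟨_, rfl⟩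
    have e1 : xstar - xplus C = -δ := by rw [hδ]; abel
    have e2 : x - η • g C - xplus C
        = (z - η • (A x C - (A w C - m))) - η • fgrad xstar - δ := by
      rw [← hgA, hδ, hz, smul_sub]; abel
    rw [e1, e2, norm_neg, inner_neg_right, inner_sub_left, inner_sub_left _ (η • fgrad xstar),
      real_inner_smul_left, real_inner_self_eq_norm_sq] at h1
    rw [← hδ] at h2 ⊢
    have h3 : (1 + η * μψ) * ‖δ‖ ^ 2 ≤ ⟪z - η • (A x C - (A w C - m)), δ⟫ := by
      have h4 := mul_le_mul_of_nonneg_left (add_le_add h1 h2) hη.le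
      have h5 : ∀ r : ℝ, η * (1 / η * r) = r := fun r => by field_simp
      simp only [mul_add, h5] at h4
      nlinarith
    refine (aux_prox _ _ _ hc h3).trans ?_
    have h6 := norm_sub_sq_real z (η • (A x C - (A w C - m)))
    have h7 := norm_sub_sq_real (A x C) (A w C - m)
    have h8 := norm_add_sq_real (A x C) (A w C - m)
    have h9 := norm_sub_sq_real (A w C) m
    have h10 := sq_nonneg ‖A x C + (A w C - m)‖
    rw [norm_smul, mul_pow, Real.norm_eq_abs, sq_abs, inner_smul_right, inner_sub_right,
      inner_sub_right] at h6
    rw [real_inner_comm] at h9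
    have h11 : ‖A x C - (A w C - m)‖ ^ 2
      ≤ 2 * ‖A x C‖ ^ 2 + 2 * ‖A w C‖ ^ 2 - 4 * ⟪m, A w C⟫ + 2 * ‖m‖ ^ 2 := by linarith
    have h12 := mul_le_mul_of_nonneg_left h11 (sq_nonneg η)
    linarith
  have hsum := Finset.sum_le_sum fun C (_ : C ∈ Finset.univ) => hpt C
  obtain ⟨G, hG⟩ : ∃ G : EuclideanSpace ℝ (Fin d) → ℝ, ∀ u, G u = ∑ C, pC C * ‖A u C‖ ^ 2 :=
    ⟨_, fun _ => rfl⟩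
  have hL : ∑ C, pC C * ((1 + η * μψ) * ‖xplus C - xstar‖ ^ 2)
      = (1 + η * μψ) * ∑ C, pC C * ‖xplus C - xstar‖ ^ 2 := by
    rw [Finset.mul_sum]
    exact Finset.sum_congr rfl fun C _ => by ring
  have hR : ∑ C, pC C * (‖z‖ ^ 2 - 2 * η * (⟪z, A x C⟫ - ⟪z, A w C⟫ + ⟪z, m⟫)
        + η ^ 2 * (2 * ‖A x C‖ ^ 2 + 2 * ‖A w C‖ ^ 2 - 4 * ⟪m, A w C⟫ + 2 * ‖m‖ ^ 2))
      = ‖z‖ ^ 2 - 2 * η * ⟪z, fgrad x - fgrad xstar⟫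
        + η ^ 2 * (2 * G x + 2 * G w - 2 * ‖m‖ ^ 2) := by
    have h1 : ∀ C, pC C * (‖z‖ ^ 2 - 2 * η * (⟪z, A x C⟫ - ⟪z, A w C⟫ + ⟪z, m⟫)
        + η ^ 2 * (2 * ‖A x C‖ ^ 2 + 2 * ‖A w C‖ ^ 2 - 4 * ⟪m, A w C⟫ + 2 * ‖m‖ ^ 2))
        = (‖z‖ ^ 2 - 2 * η * ⟪z, m⟫ + η ^ 2 * 2 * ‖m‖ ^ 2) * pC C
          + (-2 * η) * (pC C * ⟪z, A x C⟫) + (2 * η) * (pC C * ⟪z, A w C⟫)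
          + (2 * η ^ 2) * (pC C * ‖A x C‖ ^ 2) + (2 * η ^ 2) * (pC C * ‖A w C‖ ^ 2)
          + (-4 * η ^ 2) * (pC C * ⟪m, A w C⟫) := fun C => by ring
    simp only [h1, Finset.sum_add_distrib, ← Finset.mul_sum, hEi, ← hG, hpCsum]
    rw [← hm, real_inner_self_eq_norm_sq]
    ring
  rw [hL, hR] at hsum
  have hESx := hES x
  simp only [← hG] at hESx hD
  have hb := hfs x xstar
  have e3 : xstar - x = -z := by rw [hz]; abel
  rw [e3, norm_neg, inner_neg_right] at hb
  rw [← hz] at hESx ⊢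
  rw [inner_sub_right, real_inner_comm, real_inner_comm (fgrad xstar)] at hsum
  have h6 : 6 * (η * L1) ≤ 1 := by
    rw [le_div_iff₀ (by positivity)] at hη'
    linarith
  have hG0 : 0 ≤ G x := by
    rw [hG]; exact Finset.sum_nonneg fun C _ => mul_nonneg (hpC C) (sq_nonneg _)
  obtain ⟨B, hB⟩ : ∃ B, B = fbar x - fbar xstar - ⟪fgrad xstar, z⟫ := ⟨_, rfl⟩
  rw [← hB] at hESx
  have hB0 : 0 ≤ B := by
    have : 0 < 2 * L1 := by positivity
    exact nonneg_of_mul_nonneg_right (hG0.trans hESx) this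
  have h7 : 6 * η ^ 2 * G x ≤ 2 * η * B := by
    have h8 := mul_le_mul_of_nonneg_left hESx (by positivity : 0 ≤ 6 * η ^ 2)
    have h9 := mul_le_mul_of_nonneg_right h6 (by positivity : 0 ≤ 2 * η * B)
    linarith
  have hb2 := mul_le_mul_of_nonneg_left hb (by positivity : 0 ≤ 2 * η)
  have hm2 : 0 ≤ η ^ 2 * ‖m‖ ^ 2 := by positivity
  have hfin : (1 + η * μψ) * ∑ C, pC C * ‖xplus C - xstar‖ ^ 2 + 4 * η ^ 2 * G x
      ≤ (1 - η * μf) * ‖z‖ ^ 2 + 2 * η ^ 2 * G w := by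
    rw [hB] at h7
    linarith
  have hk : 0 < 1 + η * μψ := by positivity
  have e4 : p * D x = 4 * η ^ 2 * G x / (1 + η * μψ) := by
    rw [hD]; field_simp
  have e5 : p / 2 * D w = 2 * η ^ 2 * G w / (1 + η * μψ) := by
    rw [hD]; field_simp; ring
  have e6 : (1 - η * (μf + μψ) / (1 + η * μψ)) * ‖z‖ ^ 2
      = (1 - η * μf) * ‖z‖ ^ 2 / (1 + η * μψ) := by
    field_simp; ring
  have h8 : ∑ C, pC C * ‖xplus C - xstar‖ ^ 2 + 4 * η ^ 2 * G x / (1 + η * μψ)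
      ≤ (1 - η * μf) * ‖z‖ ^ 2 / (1 + η * μψ) + 2 * η ^ 2 * G w / (1 + η * μψ) := by
    rw [← add_div, le_div_iff₀ hk, add_mul, div_mul_cancel₀ _ hk.ne']
    linarith
  rw [e6, e4]
  linarith
end

section
/- Under the setup below with p ∈ (0,1], α := 3η²L_fℒ₃/p, and step size η > 0 satisfying η ≤ min{ 1/(4L_f), p^{2/3}/(36^{1/3}(L_f ℒ₃)^{1/3}), √p/√(6ℒ₃) }, for any x, w ∈ ℝ^d the following one-step descent holds: Σ_C p_C [ f(x − η g_C) + α ( p ‖η g_C‖² + (1−p) ‖x − η g_C − w‖² ) ] ≤ f(x) + α ‖x − w‖² − (η/4) ‖∇f(x)‖², where g_C := (1/n) Σ_{i∈C} θ^i_C (∇f_i(x) − ∇f_i(w)) + ∇f(w). -/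
open scoped RealInnerProductSpace BigOperators

lemma aux_descent {E : Type*} [NormedAddCommGroup E] [InnerProductSpace ℝ E] [CompleteSpace E]
    (F : E → ℝ) (F' : E → E) (hF : ∀ x, HasGradientAt F (F' x) x) (L : ℝ) (hL : 0 < L)
    (hs : LipschitzWith (Real.toNNReal L) F') (x h : E) :
    F (x + h) ≤ F x + ⟪F' x, h⟫ + L / 2 * ‖h‖ ^ 2 := by
  have hd : ∀ t : ℝ, HasDerivAt (fun t : ℝ => F (x + t • h) - t * ⟪F' x, h⟫ - L / 2 * ‖h‖ ^ 2 * t ^ 2)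
      (⟪F' (x + t • h), h⟫ - ⟪F' x, h⟫ - L * ‖h‖ ^ 2 * t) t := by
    intro t
    have h1 : HasDerivAt (fun t : ℝ => x + t • h) h t := by
      simpa using ((hasDerivAt_id t).smul_const h).const_add x
    have h2 := (hF (x + t • h)).hasFDerivAt.comp_hasDerivAt t h1
    have h3 : HasDerivAt (fun t : ℝ => t * ⟪F' x, h⟫) ⟪F' x, h⟫ t := by
      simpa using (hasDerivAt_id t).mul_const ⟪F' x, h⟫
    have h4 : HasDerivAt (fun t : ℝ => L / 2 * ‖h‖ ^ 2 * t ^ 2) (L * ‖h‖ ^ 2 * t) t := by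
      refine ((hasDerivAt_pow 2 t).const_mul (L / 2 * ‖h‖ ^ 2)).congr_deriv ?_
      push_cast
      ring
    have h5 := (h2.sub h3).sub h4
    simp only [InnerProductSpace.toDual_apply_apply] at h5
    exact h5
  have key : AntitoneOn (fun t : ℝ => F (x + t • h) - t * ⟪F' x, h⟫ - L / 2 * ‖h‖ ^ 2 * t ^ 2)
      (Set.Icc 0 1) := by
    apply antitoneOn_of_deriv_nonpos (convex_Icc 0 1)
    · exact fun t _ => (hd t).continuousAt.continuousWithinAt
    · exact fun t _ => (hd t).differentiableAt.differentiableWithinAt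
    · intro t ht
      rw [interior_Icc] at ht
      rw [(hd t).deriv, ← inner_sub_left]
      have h1 := real_inner_le_norm (F' (x + t • h) - F' x) h
      have h2 := hs.dist_le_mul (x + t • h) x
      rw [dist_eq_norm, dist_eq_norm, Real.coe_toNNReal _ hL.le, add_sub_cancel_left, norm_smul,
        Real.norm_of_nonneg ht.1.le] at h2
      nlinarith [mul_le_mul_of_nonneg_right h2 (norm_nonneg h)]
  have := key (Set.left_mem_Icc.2 zero_le_one) (Set.right_mem_Icc.2 zero_le_one) zero_le_one
  simp at this
  linarith

set_option maxHeartbeats 1000000 in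
/-- Theorem 4 of the paper: one-step descent for loopless SVRG in the
nonconvex smooth case (`ψ ≡ 0`), with `α = 3η²L_fℒ₃/p`. -/
theorem lsvrg_nonconvex_one_step
    {d n : ℕ}
    (f : Fin n → EuclideanSpace ℝ (Fin d) → ℝ)
    (f' : Fin n → EuclideanSpace ℝ (Fin d) → EuclideanSpace ℝ (Fin d))
    (hgrad : ∀ i x, HasGradientAt (f i) (f' i x) x)
    (fbar : EuclideanSpace ℝ (Fin d) → ℝ)
    (hfbar : ∀ u, fbar u = (n : ℝ)⁻¹ * ∑ i, f i u)
    (fgrad : EuclideanSpace ℝ (Fin d) → EuclideanSpace ℝ (Fin d))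
    (hfgrad : ∀ u, fgrad u = (n : ℝ)⁻¹ • ∑ i, f' i u)
    (Lf : ℝ) (hLf : 0 < Lf)
    (hfsmooth : LipschitzWith (Real.toNNReal Lf) fgrad)
    (pC : Finset (Fin n) → ℝ) (hpC : ∀ C, 0 ≤ pC C) (hpCsum : ∑ C, pC C = 1)
    (θ : Finset (Fin n) → Fin n → ℝ)
    (hunbias : ∀ i, ∑ C ∈ Finset.univ.filter (fun C => i ∈ C), pC C * θ C i = 1)
    (L3 : ℝ) (hL3 : 0 < L3)
    (hES : ∀ u v, ∑ C, pC C *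
          ‖(n : ℝ)⁻¹ • ∑ i ∈ C, θ C i • (f' i u - f' i v) - (fgrad u - fgrad v)‖ ^ 2
        ≤ L3 * ‖u - v‖ ^ 2)
    (p η : ℝ) (hp : 0 < p) (hp' : p ≤ 1) (hη0 : 0 < η)
    (hη : η ≤ min (min (1 / (4 * Lf))
        (p ^ ((2 : ℝ) / 3) / ((36 : ℝ) ^ ((1 : ℝ) / 3) * (Lf * L3) ^ ((1 : ℝ) / 3))))
        (Real.sqrt p / Real.sqrt (6 * L3)))
    (α : ℝ) (hα : α = 3 * η ^ 2 * Lf * L3 / p)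
    (x w : EuclideanSpace ℝ (Fin d))
    (g : Finset (Fin n) → EuclideanSpace ℝ (Fin d))
    (hg : ∀ C, g C = (n : ℝ)⁻¹ • ∑ i ∈ C, θ C i • (f' i x - f' i w) + fgrad w) :
    ∑ C, pC C * (fbar (x - η • g C)
        + α * (p * ‖η • g C‖ ^ 2 + (1 - p) * ‖x - η • g C - w‖ ^ 2))
      ≤ fbar x + α * ‖x - w‖ ^ 2 - η / 4 * ‖fgrad x‖ ^ 2 := by
  have hFg : ∀ u, HasGradientAt fbar (fgrad u) u := by
    intro u
    have h1 : HasFDerivAt (fun u => (n : ℝ)⁻¹ * ∑ i, f i u)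
        ((n : ℝ)⁻¹ • ∑ i, InnerProductSpace.toDual ℝ _ (f' i u)) u :=
      (HasFDerivAt.fun_sum fun i _ => (hgrad i u).hasFDerivAt).const_mul _
    rw [hasGradientAt_iff_hasFDerivAt, funext hfbar, hfgrad u]
    simpa [map_sum] using h1
  have hmean : ∑ C, pC C • g C = fgrad x := by
    have h1 : ∑ C, pC C • ∑ i ∈ C, θ C i • (f' i x - f' i w) = ∑ i, (f' i x - f' i w) := by
      calc _ = ∑ C, ∑ i, if i ∈ C then (pC C * θ C i) • (f' i x - f' i w) else 0 := by
            refine Finset.sum_congr rfl fun C _ => ?_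
            rw [Finset.smul_sum]
            simp [smul_smul, Finset.sum_ite_mem]
        _ = ∑ i, ∑ C, if i ∈ C then (pC C * θ C i) • (f' i x - f' i w) else 0 :=
            Finset.sum_comm
        _ = _ := by
            refine Finset.sum_congr rfl fun i _ => ?_
            rw [← Finset.sum_filter, ← Finset.sum_smul, hunbias, one_smul]
    simp only [hg, smul_add, Finset.sum_add_distrib, ← Finset.sum_smul, hpCsum, one_smul]
    simp only [smul_comm _ ((n : ℝ)⁻¹), ← Finset.smul_sum]
    rw [h1, Finset.sum_sub_distrib, smul_sub, ← hfgrad, ← hfgrad]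
    abel
  have hin : ∀ v, ∑ C, pC C * ⟪v, g C⟫ = ⟪v, fgrad x⟫ := by
    intro v
    rw [← hmean, inner_sum]
    simp [inner_smul_right]
  have hvar : ∑ C, pC C * ‖g C‖ ^ 2 ≤ ‖fgrad x‖ ^ 2 + L3 * ‖x - w‖ ^ 2 := by
    have h0 := hES x w
    have h1 : ∑ C, pC C *
          ‖(n : ℝ)⁻¹ • ∑ i ∈ C, θ C i • (f' i x - f' i w) - (fgrad x - fgrad w)‖ ^ 2
        = ∑ C, (pC C * ‖g C‖ ^ 2 - 2 * (pC C * ⟪fgrad x, g C⟫) + pC C * ‖fgrad x‖ ^ 2) := by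
      refine Finset.sum_congr rfl fun C _ => ?_
      have : (n : ℝ)⁻¹ • ∑ i ∈ C, θ C i • (f' i x - f' i w) - (fgrad x - fgrad w)
        = g C - fgrad x := by rw [hg]; abel
      rw [this, norm_sub_sq_real, real_inner_comm]
      ring
    rw [h1, Finset.sum_add_distrib, Finset.sum_sub_distrib, ← Finset.mul_sum, hin,
      ← Finset.sum_mul, hpCsum, real_inner_self_eq_norm_sq] at h0
    linarith
  obtain ⟨⟨hη1, hη2⟩, hη3⟩ := by simpa only [le_min_iff] using hη
  have e1 : η * Lf ≤ 1 / 4 := by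
    rw [le_div_iff₀ (by positivity)] at hη1
    linarith
  have e2 : 36 * (η ^ 3 * (Lf * L3)) ≤ p ^ 2 := by
    rw [le_div_iff₀ (by positivity)] at hη2
    have h1 := pow_le_pow_left₀ (by positivity) hη2 3
    have c1 : (p ^ ((2 : ℝ) / 3)) ^ 3 = p ^ 2 := by
      rw [← Real.rpow_natCast, ← Real.rpow_mul hp.le, ← Real.rpow_natCast]; norm_num
    have c2 : ∀ y : ℝ, 0 ≤ y → (y ^ ((1 : ℝ) / 3)) ^ 3 = y := by
      intro y hy
      rw [← Real.rpow_natCast, ← Real.rpow_mul hy]; norm_num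
    rw [mul_pow, mul_pow, c1, c2 _ (by norm_num), c2 _ (by positivity)] at h1
    linarith
  have e3 : 6 * (η ^ 2 * L3) ≤ p := by
    rw [le_div_iff₀ (by positivity)] at hη3
    have h1 := pow_le_pow_left₀ (by positivity) hη3 2
    rw [mul_pow, Real.sq_sqrt (by positivity), Real.sq_sqrt hp.le] at h1
    linarith
  have hα0 : 0 < α := by rw [hα]; positivity
  have hαp : α * p = 3 * η ^ 2 * Lf * L3 := by rw [hα]; field_simp
  have step : ∀ C, pC C * (fbar (x - η • g C)
        + α * (p * ‖η • g C‖ ^ 2 + (1 - p) * ‖x - η • g C - w‖ ^ 2))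
      ≤ pC C * (fbar x + α * (1 - p) * ‖x - w‖ ^ 2) - η * (pC C * ⟪fgrad x, g C⟫)
        + (Lf / 2 * η ^ 2 + α * η ^ 2) * (pC C * ‖g C‖ ^ 2)
        - 2 * α * (1 - p) * η * (pC C * ⟪x - w, g C⟫) := by
    intro C
    have h1 := aux_descent fbar fgrad hFg Lf hLf hfsmooth x (-(η • g C))
    rw [← sub_eq_add_neg, norm_neg, inner_neg_right, inner_smul_right, norm_smul,
      Real.norm_of_nonneg hη0.le] at h1
    have h2 : ‖x - η • g C - w‖ ^ 2 = ‖x - w‖ ^ 2 - 2 * (η * ⟪x - w, g C⟫) + (η * ‖g C‖) ^ 2 := by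
      rw [show x - η • g C - w = (x - w) - η • g C by abel, norm_sub_sq_real, inner_smul_right,
        norm_smul, Real.norm_of_nonneg hη0.le]
    rw [h2, norm_smul, Real.norm_of_nonneg hη0.le]
    have h3 := mul_le_mul_of_nonneg_left h1 (hpC C)
    linarith
  refine (Finset.sum_le_sum fun C _ => step C).trans ?_
  rw [Finset.sum_sub_distrib, Finset.sum_add_distrib, Finset.sum_sub_distrib, ← Finset.mul_sum,
    ← Finset.mul_sum, ← Finset.mul_sum, ← Finset.sum_mul, hpCsum, hin, hin,
    real_inner_self_eq_norm_sq]
  have hv := mul_le_mul_of_nonneg_left hvar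
    (show 0 ≤ Lf / 2 * η ^ 2 + α * η ^ 2 by positivity)
  -- Young
  have hy : -(2 * p * η * ⟪x - w, fgrad x⟫) ≤ 2 / 3 * p ^ 2 * ‖x - w‖ ^ 2
      + 3 / 2 * η ^ 2 * ‖fgrad x‖ ^ 2 := by
    have := neg_le_of_abs_le (abs_real_inner_le_norm (x - w) (fgrad x))
    have h2 := mul_le_mul_of_nonneg_left this (show 0 ≤ 2 * p * η by positivity)
    nlinarith [sq_nonneg (2 * p * ‖x - w‖ - 3 * η * ‖fgrad x‖)]
  have hA : 0 ≤ ‖x - w‖ ^ 2 := sq_nonneg _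
  have hB : 0 ≤ ‖fgrad x‖ ^ 2 := sq_nonneg _
  clear step hES hmean hin hvar hη1 hη2 hη3 hη
  generalize ‖x - w‖ ^ 2 = A at *
  generalize ‖fgrad x‖ ^ 2 = B at *
  generalize ⟪x - w, fgrad x⟫ = I at *
  generalize fbar x = F at *
  obtain ⟨γ, hγ⟩ : ∃ γ, γ = α / p := ⟨_, rfl⟩
  have hαγ : α = γ * p := by rw [hγ]; field_simp
  have hγ0 : 0 < γ := by rw [hγ]; positivity
  have hγη : γ * η ^ 2 ≤ η / 12 := by
    have : γ * p ^ 2 = 3 * η ^ 2 * Lf * L3 := by rw [← hαp, hαγ]; ring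
    have h2 : (γ * η ^ 2) * p ^ 2 ≤ η / 12 * p ^ 2 := by
      have := congrArg (fun z => η ^ 2 * z) this
      linarith [mul_le_mul_of_nonneg_left e2 hη0.le]
    exact le_of_mul_le_mul_right h2 (by positivity)
  have y2 : -(2 * α * (1 - p) * η * I) ≤ (1 - p) * (2 / 3 * (α * p) * A + 3 / 2 * (γ * η ^ 2) * B) := by
    have := mul_le_mul_of_nonneg_left hy (mul_nonneg hγ0.le (sub_nonneg.2 hp'))
    rw [hαγ]
    linarith
  have y3 : (1 - p) * (2 / 3 * (α * p) * A + 3 / 2 * (γ * η ^ 2) * B)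
      ≤ 2 / 3 * (α * p) * A + 3 / 2 * (γ * η ^ 2) * B := by
    have : 0 ≤ 2 / 3 * (α * p) * A + 3 / 2 * (γ * η ^ 2) * B := by positivity
    exact mul_le_of_le_one_left this (by linarith)
  have y4 : γ * η ^ 2 * B ≤ η / 12 * B := mul_le_mul_of_nonneg_right hγη hB
  have y5 : α * η ^ 2 * B ≤ η / 12 * B := by
    refine mul_le_mul_of_nonneg_right (le_trans ?_ hγη) hB
    rw [hαγ]
    exact mul_le_mul_of_nonneg_right (mul_le_of_le_one_right hγ0.le hp') (sq_nonneg _)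
  have y6 : Lf / 2 * η ^ 2 * B ≤ η / 8 * B := by
    refine mul_le_mul_of_nonneg_right ?_ hB
    have := mul_le_mul_of_nonneg_left e1 hη0.le
    linarith
  have y7 : Lf / 2 * η ^ 2 * (L3 * A) = α * p / 6 * A := by rw [hαp]; ring
  have y8 : α * η ^ 2 * (L3 * A) ≤ α * p / 6 * A := by
    linarith [mul_le_mul_of_nonneg_left e3 (mul_nonneg hα0.le hA)]
  have y9 : 0 ≤ η * B := by positivity
  linarith
end

section
/- Let f_i : ℝ^d → ℝ be differentiable with f = (1/n) Σ_{i=1}^n f_i, let x* ∈ ℝ^d, and let the sampling with weights θ be unbiased and satisfy: there is ℒ₁ > 0 with E_S ‖(1/n) Σ_{i∈S} θ^i_S (∇f_i(u) − ∇f_i(x*))‖² ≤ 2 ℒ₁ (f(u) − f(x*) − ⟨∇f(x*), u − x*⟩) for all u ∈ ℝ^d. Then for any x, w ∈ ℝ^d, with g_C := (1/n) Σ_{i∈C} θ^i_C (∇f_i(x) − ∇f_i(w)) + ∇f(w), one has Σ_C p_C ‖g_C − ∇f(x*)‖² ≤ 4 ℒ₁ (f(x) − f(x*) − ⟨∇f(x*),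 x − x*⟩) + 2 E_S ‖(1/n) Σ_{i∈S} θ^i_S (∇f_i(w) − ∇f_i(x*))‖². -/
open scoped RealInnerProductSpace BigOperators

/-- Lemma `gk2`, Appendix B: second-moment bound on the L-SVRG
gradient estimator around `∇f(x*)`. -/
theorem lsvrg_estimator_second_moment
    {d n : ℕ}
    (f : Fin n → EuclideanSpace ℝ (Fin d) → ℝ)
    (f' : Fin n → EuclideanSpace ℝ (Fin d) → EuclideanSpace ℝ (Fin d))
    (hgrad : ∀ i x, HasGradientAt (f i) (f' i x) x)
    (fbar : EuclideanSpace ℝ (Fin d) → ℝ)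
    (hfbar : ∀ u, fbar u = (n : ℝ)⁻¹ * ∑ i, f i u)
    (fgrad : EuclideanSpace ℝ (Fin d) → EuclideanSpace ℝ (Fin d))
    (hfgrad : ∀ u, fgrad u = (n : ℝ)⁻¹ • ∑ i, f' i u)
    (xstar : EuclideanSpace ℝ (Fin d))
    (pC : Finset (Fin n) → ℝ) (hpC : ∀ C, 0 ≤ pC C) (hpCsum : ∑ C, pC C = 1)
    (θ : Finset (Fin n) → Fin n → ℝ)
    (hunbias : ∀ i, ∑ C ∈ Finset.univ.filter (fun C => i ∈ C), pC C * θ C i = 1)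
    (L1 : ℝ) (hL1 : 0 < L1)
    (hES : ∀ u, ∑ C, pC C * ‖(n : ℝ)⁻¹ • ∑ i ∈ C, θ C i • (f' i u - f' i xstar)‖ ^ 2
        ≤ 2 * L1 * (fbar u - fbar xstar - ⟪fgrad xstar, u - xstar⟫))
    (x w : EuclideanSpace ℝ (Fin d))
    (g : Finset (Fin n) → EuclideanSpace ℝ (Fin d))
    (hg : ∀ C, g C = (n : ℝ)⁻¹ • ∑ i ∈ C, θ C i • (f' i x - f' i w) + fgrad w) :
    ∑ C, pC C * ‖g C - fgrad xstar‖ ^ 2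
      ≤ 4 * L1 * (fbar x - fbar xstar - ⟪fgrad xstar, x - xstar⟫)
        + 2 * ∑ C, pC C * ‖(n : ℝ)⁻¹ • ∑ i ∈ C, θ C i • (f' i w - f' i xstar)‖ ^ 2 := by
  have hmean : ∑ C, pC C • ((n : ℝ)⁻¹ • ∑ i ∈ C, θ C i • (f' i w - f' i xstar))
      = fgrad w - fgrad xstar := by
    have h1 : ∀ C : Finset (Fin n),
        pC C • ((n : ℝ)⁻¹ • ∑ i ∈ C, θ C i • (f' i w - f' i xstar))
        = (n : ℝ)⁻¹ • ∑ i, (if i ∈ C then pC C * θ C i else 0) • (f' i w - f' i xstar) := by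
      intro C
      rw [smul_comm, Finset.smul_sum]
      congr 1
      simp only [ite_smul, zero_smul, Finset.sum_ite_mem, Finset.univ_inter, smul_smul]
    simp only [h1]
    rw [← Finset.smul_sum, Finset.sum_comm, hfgrad, hfgrad, ← smul_sub, ← Finset.sum_sub_distrib]
    congr 1
    refine Finset.sum_congr rfl fun i _ => ?_
    rw [← Finset.sum_smul, ← Finset.sum_filter, hunbias, one_smul]
  have hx := hES x
  set A : Finset (Fin n) → EuclideanSpace ℝ (Fin d) :=
    fun C => (n : ℝ)⁻¹ • ∑ i ∈ C, θ C i • (f' i x - f' i xstar) with hA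
  set B : Finset (Fin n) → EuclideanSpace ℝ (Fin d) :=
    fun C => (n : ℝ)⁻¹ • ∑ i ∈ C, θ C i • (f' i w - f' i xstar) with hB
  set m := fgrad w - fgrad xstar with hm
  have hgC : ∀ C, g C - fgrad xstar = A C - (B C - m) := by
    intro C
    have : (n : ℝ)⁻¹ • ∑ i ∈ C, θ C i • (f' i x - f' i w) = A C - B C := by
      simp only [hA, hB]
      rw [← smul_sub, ← Finset.sum_sub_distrib]
      congr 1
      refine Finset.sum_congr rfl fun i _ => ?_
      rw [← smul_sub]
      congr 1
      abel
    rw [hg, this, hm]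
    abel
  have hpt : ∀ C, ‖g C - fgrad xstar‖ ^ 2
      ≤ 2 * ‖A C‖ ^ 2 + 2 * ‖B C‖ ^ 2 - 4 * ⟪B C, m⟫ + 2 * ‖m‖ ^ 2 := by
    intro C
    rw [hgC]
    have h1 := parallelogram_law_with_norm ℝ (A C) (B C - m)
    have h2 := norm_sub_sq_real (B C) m
    nlinarith [sq_nonneg ‖A C + (B C - m)‖]
  have hin : ∑ C, pC C * ⟪B C, m⟫ = ‖m‖ ^ 2 := by
    rw [← real_inner_self_eq_norm_sq]
    nth_rewrite 2 [← hmean]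
    rw [sum_inner]
    simp only [real_inner_smul_left, hB]
  have hs : ∑ C, pC C * ‖g C - fgrad xstar‖ ^ 2
      ≤ 2 * ∑ C, pC C * ‖A C‖ ^ 2 + 2 * ∑ C, pC C * ‖B C‖ ^ 2
        - 4 * ∑ C, pC C * ⟪B C, m⟫ + 2 * ‖m‖ ^ 2 * ∑ C, pC C := by
    simp only [Finset.mul_sum]
    rw [← Finset.sum_add_distrib, ← Finset.sum_sub_distrib, ← Finset.sum_add_distrib]
    refine Finset.sum_le_sum fun C _ => ?_
    have := mul_le_mul_of_nonneg_left (hpt C) (hpC C)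
    linarith
  rw [hin, hpCsum] at hs
  change ∑ C, pC C * ‖A C‖ ^ 2 ≤ _ at hx
  change _ ≤ _ + 2 * ∑ C, pC C * ‖B C‖ ^ 2
  linarith [sq_nonneg ‖m‖]
end

section
/- Let ψ : ℝ^d → ℝ be convex and μ_ψ-strongly convex, let L, η > 0, μ_f ≥ 0, and set σ₁ := μ_f/L, σ₂ := μ_ψ/L, σ := σ₁ + σ₂. Let g, x, z, x* ∈ ℝ^d be arbitrary and suppose z⁺ minimizes over ℝ^d the function u ↦ ψ(u) + ((1+ησ₁)L/(2η)) ‖u − (ησ₁ x + z − (η/L) g)/(1+ησ₁)‖². Then ⟨g, x* − z⁺⟩ + (μ_f/2) ‖x − x*‖² ≥ (L/(2η)) ‖z − z⁺‖² + (L(1+ησ)/(2η)) ‖z⁺ − x*‖² − (L/(2η)) ‖z − x*‖² + ψ(z⁺) − ψ(x*). -/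
open scoped RealInnerProductSpace BigOperators

theorem aux_strong_min {E : Type*} [NormedAddCommGroup E] [InnerProductSpace ℝ E]
    (F : E → ℝ) (m : ℝ) (hm : 0 ≤ m) (hF : StrongConvexOn Set.univ m F) (a : E)
    (ha : ∀ u, F a ≤ F u) (b : E) : F a + m / 2 * ‖a - b‖ ^ 2 ≤ F b := by
  have key : ∀ t : ℝ, 0 < t → t < 1 → (1 - t) * (m / 2 * ‖a - b‖ ^ 2) ≤ F b - F a := by
    intro t h0 h1
    have h := hF.2 (Set.mem_univ a) (Set.mem_univ b) (sub_nonneg.2 h1.le) h0.le (by ring)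
    have h2 := ha ((1 - t) • a + t • b)
    simp only [smul_eq_mul] at h
    have : t * ((1 - t) * (m / 2 * ‖a - b‖ ^ 2)) ≤ t * (F b - F a) := by linarith
    exact le_of_mul_le_mul_left this h0
  have hM : 0 ≤ m / 2 * ‖a - b‖ ^ 2 := by positivity
  generalize m / 2 * ‖a - b‖ ^ 2 = M at *
  by_contra! hc
  have hA := ha b
  have hMp : 0 < M := by linarith
  have := key ((M - (F b - F a)) / (2 * M)) (div_pos (by linarith) (by linarith))
    ((div_lt_one (by linarith)).2 (by linarith))
  have e : (1 - (M - (F b - F a)) / (2 * M)) * M = (M + (F b - F a)) / 2 := by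
    field_simp
    ring
  linarith

/-- Lemma `couple1`, Appendix C: deterministic proximal inequality used in
the analysis of loopless Katyusha.  Here `σ₁ = μ_f/L`, `σ₂ = μ_ψ/L`, `σ = σ₁ + σ₂`. -/
theorem katyusha_prox_inequality
    {d : ℕ}
    (ψ : EuclideanSpace ℝ (Fin d) → ℝ)
    (μψ : ℝ) (hμψ : 0 ≤ μψ)
    (hψconv : ConvexOn ℝ Set.univ ψ)
    (hψsc : ConvexOn ℝ Set.univ (fun u => ψ u - μψ / 2 * ‖u‖ ^ 2))
    (L η μf : ℝ) (hL : 0 < L) (hη : 0 < η) (hμf : 0 ≤ μf)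
    (g x z xstar zplus : EuclideanSpace ℝ (Fin d))
    (hzplus : ∀ u,
      ψ zplus + (1 + η * (μf / L)) * L / (2 * η) *
          ‖zplus - (1 + η * (μf / L))⁻¹ • ((η * (μf / L)) • x + z - (η / L) • g)‖ ^ 2
        ≤ ψ u + (1 + η * (μf / L)) * L / (2 * η) *
          ‖u - (1 + η * (μf / L))⁻¹ • ((η * (μf / L)) • x + z - (η / L) • g)‖ ^ 2) :
    ⟪g, xstar - zplus⟫ + μf / 2 * ‖x - xstar‖ ^ 2
      ≥ L / (2 * η) * ‖z - zplus‖ ^ 2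
        + L * (1 + η * (μf / L + μψ / L)) / (2 * η) * ‖zplus - xstar‖ ^ 2
        - L / (2 * η) * ‖z - xstar‖ ^ 2
        + ψ zplus - ψ xstar := by
  have hc : 0 < 1 + η * (μf / L) := by positivity
  set p := (1 + η * (μf / L))⁻¹ • ((η * (μf / L)) • x + z - (η / L) • g) with hp
  set c := (1 + η * (μf / L)) * L / (2 * η) with hcdef
  have hc0 : 0 < c := by positivity
  have hpe : (1 + η * (μf / L)) • p = (η * (μf / L)) • x + z - (η / L) • g := by
    rw [hp, smul_inv_smul₀ hc.ne']
  have hF : StrongConvexOn Set.univ (μψ + 2 * c) (fun u => ψ u + c * ‖u - p‖ ^ 2) := by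
    rw [strongConvexOn_iff_convex]
    have hl : ConvexOn ℝ Set.univ (fun u : EuclideanSpace ℝ (Fin d) =>
        ((-2 * c) • (innerSL ℝ p).toLinearMap) u) := LinearMap.convexOn _ convex_univ
    have h3 := (hψsc.add hl).add_const (c * ‖p‖ ^ 2)
    refine ConvexOn.congr h3 ?_
    intro u _
    simp only [Pi.add_apply, LinearMap.smul_apply, ContinuousLinearMap.coe_coe,
      innerSL_apply_apply, smul_eq_mul]
    rw [norm_sub_sq_real, real_inner_comm]
    ring
  have h := aux_strong_min _ _ (by positivity) hF zplus hzplus xstar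
  have q : ∀ u v : EuclideanSpace ℝ (Fin d), c * ‖u - p‖ ^ 2 - c * ‖v - p‖ ^ 2
      = L / (2 * η) * (‖z - u‖ ^ 2 - ‖z - v‖ ^ 2) + μf / 2 * (‖x - u‖ ^ 2 - ‖x - v‖ ^ 2)
        + ⟪g, u - v⟫ := by
    intro u v
    have hi := congrArg (fun w => ⟪w, u - v⟫) hpe
    simp only [inner_add_left, inner_sub_left, real_inner_smul_left, inner_sub_right] at hi
    simp only [norm_sub_sq_real, inner_sub_right, real_inner_comm p]
    have hi2 : 2 * c * (⟪p, u⟫ - ⟪p, v⟫) = μf * (⟪x, u⟫ - ⟪x, v⟫)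
        + L / η * (⟪z, u⟫ - ⟪z, v⟫) - (⟪g, u⟫ - ⟪g, v⟫) := by
      have : 2 * c * (⟪p, u⟫ - ⟪p, v⟫)
        = L / η * ((1 + η * (μf / L)) * (⟪p, u⟫ - ⟪p, v⟫)) := by rw [hcdef]; field_simp
      rw [this, mul_sub (1 + η * (μf / L)), hi]
      field_simp
      ring
    have hc2 : c = L / (2 * η) + μf / 2 := by rw [hcdef]; field_simp
    have e1 : L / η = 2 * (L / (2 * η)) := by field_simp
    rw [e1] at hi2
    linear_combination (‖u‖ ^ 2 - ‖v‖ ^ 2) * hc2 - hi2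
  have hq := q xstar zplus
  have e : L * (1 + η * (μf / L + μψ / L)) / (2 * η) = (μψ + 2 * c) / 2 := by
    rw [hcdef]; field_simp; ring
  rw [e]
  have : 0 ≤ μf / 2 * ‖x - zplus‖ ^ 2 := by positivity
  linarith
end

section
/- Let f_i : ℝ^d → ℝ be differentiable with f = (1/n) Σ_{i=1}^n f_i, let x* ∈ ℝ^d, and let the sampling with weights θ be unbiased and satisfy: there is ℒ₁ > 0 with E_S ‖(1/n) Σ_{i∈S} θ^i_S (∇f_i(u) − ∇f_i(x*))‖² ≤ 2 ℒ₁ (f(u) − f(x*) − ⟨∇f(x*), u − x*⟩) for all u ∈ ℝ^d. Then for any x, w ∈ ℝ^d, with g_C := (1/n) Σ_{i∈C} θ^i_C (∇f_i(x) − ∇f_i(w)) + ∇f(w), one has Σ_C p_C ‖g_C − ∇f(x)‖² ≤ 4 ℒ₁ (f(x) − f(x*) − ⟨∇f(x*), x − x*⟩) + 2 E_S ‖(1/n) Σ_{i∈S} θ^i_S (∇f_i(w) − ∇f_i(x*))‖². -/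
open scoped RealInnerProductSpace BigOperators

/-- Lemma `gkgconvex`, Appendix D: variance bound on the L-SVRG
gradient estimator around the true gradient `∇f(x)`. -/
theorem lsvrg_estimator_variance
    {d n : ℕ}
    (f : Fin n → EuclideanSpace ℝ (Fin d) → ℝ)
    (f' : Fin n → EuclideanSpace ℝ (Fin d) → EuclideanSpace ℝ (Fin d))
    (hgrad : ∀ i x, HasGradientAt (f i) (f' i x) x)
    (fbar : EuclideanSpace ℝ (Fin d) → ℝ)
    (hfbar : ∀ u, fbar u = (n : ℝ)⁻¹ * ∑ i, f i u)
    (fgrad : EuclideanSpace ℝ (Fin d) → EuclideanSpace ℝ (Fin d))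
    (hfgrad : ∀ u, fgrad u = (n : ℝ)⁻¹ • ∑ i, f' i u)
    (xstar : EuclideanSpace ℝ (Fin d))
    (pC : Finset (Fin n) → ℝ) (hpC : ∀ C, 0 ≤ pC C) (hpCsum : ∑ C, pC C = 1)
    (θ : Finset (Fin n) → Fin n → ℝ)
    (hunbias : ∀ i, ∑ C ∈ Finset.univ.filter (fun C => i ∈ C), pC C * θ C i = 1)
    (L1 : ℝ) (hL1 : 0 < L1)
    (hES : ∀ u, ∑ C, pC C * ‖(n : ℝ)⁻¹ • ∑ i ∈ C, θ C i • (f' i u - f' i xstar)‖ ^ 2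
        ≤ 2 * L1 * (fbar u - fbar xstar - ⟪fgrad xstar, u - xstar⟫))
    (x w : EuclideanSpace ℝ (Fin d))
    (g : Finset (Fin n) → EuclideanSpace ℝ (Fin d))
    (hg : ∀ C, g C = (n : ℝ)⁻¹ • ∑ i ∈ C, θ C i • (f' i x - f' i w) + fgrad w) :
    ∑ C, pC C * ‖g C - fgrad x‖ ^ 2
      ≤ 4 * L1 * (fbar x - fbar xstar - ⟪fgrad xstar, x - xstar⟫)
        + 2 * ∑ C, pC C * ‖(n : ℝ)⁻¹ • ∑ i ∈ C, θ C i • (f' i w - f' i xstar)‖ ^ 2 := by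
  have hmean : ∑ C, pC C • ((n : ℝ)⁻¹ • ∑ i ∈ C, θ C i • (f' i x - f' i w))
      = fgrad x - fgrad w := by
    have h1 : ∀ C : Finset (Fin n),
        pC C • ((n : ℝ)⁻¹ • ∑ i ∈ C, θ C i • (f' i x - f' i w))
        = (n : ℝ)⁻¹ • ∑ i, (if i ∈ C then pC C * θ C i else 0) • (f' i x - f' i w) := by
      intro C
      rw [smul_comm, Finset.smul_sum]
      congr 1
      simp only [ite_smul, zero_smul, Finset.sum_ite_mem, Finset.univ_inter, mul_smul]
    rw [Finset.sum_congr rfl (fun C _ => h1 C), ← Finset.smul_sum, Finset.sum_comm,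
      hfgrad, hfgrad, ← smul_sub, ← Finset.sum_sub_distrib]
    congr 1
    refine Finset.sum_congr rfl fun i _ => ?_
    rw [← Finset.sum_smul, ← Finset.sum_filter, hunbias i, one_smul]
  have hsplit : ∀ C : Finset (Fin n), (n : ℝ)⁻¹ • ∑ i ∈ C, θ C i • (f' i x - f' i w)
      = (n : ℝ)⁻¹ • ∑ i ∈ C, θ C i • (f' i x - f' i xstar)
        - (n : ℝ)⁻¹ • ∑ i ∈ C, θ C i • (f' i w - f' i xstar) := by
    intro C
    rw [← smul_sub, ← Finset.sum_sub_distrib]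
    congr 1
    refine Finset.sum_congr rfl fun i _ => ?_
    rw [← smul_sub, sub_sub_sub_cancel_right]
  have hx := hES x
  obtain ⟨A, hA'⟩ : ∃ A : Finset (Fin n) → EuclideanSpace ℝ (Fin d), ∀ C,
      (n : ℝ)⁻¹ • ∑ i ∈ C, θ C i • (f' i x - f' i xstar) = A C := ⟨_, fun _ => rfl⟩
  obtain ⟨B, hB'⟩ : ∃ B : Finset (Fin n) → EuclideanSpace ℝ (Fin d), ∀ C,
      (n : ℝ)⁻¹ • ∑ i ∈ C, θ C i • (f' i w - f' i xstar) = B C := ⟨_, fun _ => rfl⟩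
  obtain ⟨D, hD'⟩ : ∃ D : Finset (Fin n) → EuclideanSpace ℝ (Fin d), ∀ C,
      (n : ℝ)⁻¹ • ∑ i ∈ C, θ C i • (f' i x - f' i w) = D C := ⟨_, fun _ => rfl⟩
  simp only [hD'] at hmean hg
  simp only [hA', hB', hD'] at hsplit
  simp only [hA'] at hx
  simp only [hB']
  have hvar : ∑ C, pC C * ‖g C - fgrad x‖ ^ 2
      = ∑ C, pC C * ‖D C‖ ^ 2 - ‖fgrad x - fgrad w‖ ^ 2 := by
    have h2 : ∀ C, pC C * ‖g C - fgrad x‖ ^ 2 = pC C * ‖D C‖ ^ 2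
        - 2 * ⟪pC C • D C, fgrad x - fgrad w⟫ + pC C * ‖fgrad x - fgrad w‖ ^ 2 := by
      intro C
      have : g C - fgrad x = D C - (fgrad x - fgrad w) := by rw [hg]; abel
      rw [this, norm_sub_sq_real, real_inner_smul_left]
      ring
    rw [Finset.sum_congr rfl (fun C _ => h2 C), Finset.sum_add_distrib,
      Finset.sum_sub_distrib, ← Finset.mul_sum, ← sum_inner, hmean, ← Finset.sum_mul, hpCsum,
      real_inner_self_eq_norm_sq]
    ring
  have hle : ∑ C, pC C * ‖D C‖ ^ 2
      ≤ 2 * ∑ C, pC C * ‖A C‖ ^ 2 + 2 * ∑ C, pC C * ‖B C‖ ^ 2 := by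
    rw [Finset.mul_sum, Finset.mul_sum, ← Finset.sum_add_distrib]
    refine Finset.sum_le_sum fun C _ => ?_
    have h3 := parallelogram_law_with_norm ℝ (A C) (B C)
    have h4 : ‖D C‖ ^ 2 ≤ 2 * ‖A C‖ ^ 2 + 2 * ‖B C‖ ^ 2 := by
      rw [hsplit C]
      nlinarith [mul_self_nonneg ‖A C + B C‖]
    nlinarith [mul_le_mul_of_nonneg_left h4 (hpC C)]
  nlinarith [sq_nonneg ‖fgrad x - fgrad w‖]
end

section
/- Let f_i : ℝ^d → ℝ be differentiable with f = (1/n) Σ_{i=1}^n f_i, and let the sampling with weights θ be unbiased. Fix x, w ∈ ℝ^d, η > 0, p ∈ [0,1], and set g_C := (1/n) Σ_{i∈C} θ^i_C (∇f_i(x) − ∇f_i(w)) + ∇f(w). Then for every β > 0: Σ_C p_C [ p ‖η g_C‖² + (1−p) ‖x − η g_C − w‖² ] ≤ η² Σ_C p_C ‖g_C‖² + (1−p)(1+ηβ) ‖x − w‖² + (1−p) (η/β) ‖∇f(x)‖². -/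
open scoped RealInnerProductSpace BigOperators

/-- Lemma `x-wnonconvex`, Appendix E: bound on the expected squared distance
between the new iterate and the new reference point. -/
theorem lsvrg_iterate_reference_distance
    {d n : ℕ}
    (f : Fin n → EuclideanSpace ℝ (Fin d) → ℝ)
    (f' : Fin n → EuclideanSpace ℝ (Fin d) → EuclideanSpace ℝ (Fin d))
    (hgrad : ∀ i x, HasGradientAt (f i) (f' i x) x)
    (fgrad : EuclideanSpace ℝ (Fin d) → EuclideanSpace ℝ (Fin d))
    (hfgrad : ∀ u, fgrad u = (n : ℝ)⁻¹ • ∑ i, f' i u)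
    (pC : Finset (Fin n) → ℝ) (hpC : ∀ C, 0 ≤ pC C) (hpCsum : ∑ C, pC C = 1)
    (θ : Finset (Fin n) → Fin n → ℝ)
    (hunbias : ∀ i, ∑ C ∈ Finset.univ.filter (fun C => i ∈ C), pC C * θ C i = 1)
    (x w : EuclideanSpace ℝ (Fin d))
    (η : ℝ) (hη : 0 < η) (p : ℝ) (hp : 0 ≤ p) (hp' : p ≤ 1)
    (g : Finset (Fin n) → EuclideanSpace ℝ (Fin d))
    (hg : ∀ C, g C = (n : ℝ)⁻¹ • ∑ i ∈ C, θ C i • (f' i x - f' i w) + fgrad w) :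
    ∀ β : ℝ, 0 < β →
      ∑ C, pC C * (p * ‖η • g C‖ ^ 2 + (1 - p) * ‖x - η • g C - w‖ ^ 2)
        ≤ η ^ 2 * ∑ C, pC C * ‖g C‖ ^ 2
          + (1 - p) * (1 + η * β) * ‖x - w‖ ^ 2
          + (1 - p) * (η / β) * ‖fgrad x‖ ^ 2 := by
  have hsum : ∑ C, pC C • g C = fgrad x := by
    have h1 : ∑ C, pC C • ∑ i ∈ C, θ C i • (f' i x - f' i w) = ∑ i, (f' i x - f' i w) := by
      have h2 : ∀ C : Finset (Fin n), pC C • ∑ i ∈ C, θ C i • (f' i x - f' i w)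
          = ∑ i, if i ∈ C then (pC C * θ C i) • (f' i x - f' i w) else 0 := by
        intro C
        rw [Finset.smul_sum, Finset.sum_ite_mem, Finset.univ_inter]
        exact Finset.sum_congr rfl fun i _ => by rw [smul_smul]
      rw [Finset.sum_congr rfl fun C _ => h2 C, Finset.sum_comm]
      refine Finset.sum_congr rfl fun i _ => ?_
      rw [← Finset.sum_filter, ← Finset.sum_smul, hunbias i, one_smul]
    have h3 : ∀ C, pC C • g C = (n : ℝ)⁻¹ • (pC C • ∑ i ∈ C, θ C i • (f' i x - f' i w))
        + pC C • fgrad w := by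
      intro C
      rw [hg C, smul_add, smul_comm]
    rw [Finset.sum_congr rfl fun C _ => h3 C, Finset.sum_add_distrib, ← Finset.smul_sum, h1,
      ← Finset.sum_smul, hpCsum, one_smul, Finset.sum_sub_distrib, smul_sub, ← hfgrad, ← hfgrad]
    abel
  intro β hβ
  have hin : ∑ C, pC C * ⟪x - w, g C⟫ = ⟪x - w, fgrad x⟫ := by
    rw [← hsum, inner_sum]
    exact Finset.sum_congr rfl fun C _ => by rw [real_inner_smul_right]
  have hterm : ∀ C, pC C * (p * ‖η • g C‖ ^ 2 + (1 - p) * ‖x - η • g C - w‖ ^ 2)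
      = η ^ 2 * (pC C * ‖g C‖ ^ 2) + (1 - p) * ‖x - w‖ ^ 2 * pC C
        - 2 * (1 - p) * η * (pC C * ⟪x - w, g C⟫) := by
    intro C
    have e : x - η • g C - w = (x - w) - η • g C := by abel
    rw [e, norm_sub_sq_real, real_inner_smul_right, norm_smul, mul_pow, Real.norm_eq_abs, sq_abs]
    ring
  rw [Finset.sum_congr rfl fun C _ => hterm C, Finset.sum_sub_distrib, Finset.sum_add_distrib,
    ← Finset.mul_sum, ← Finset.mul_sum, ← Finset.mul_sum, hin, hpCsum]
  have hy : 0 ≤ β * ‖x - w‖ ^ 2 + 2 * ⟪x - w, fgrad x⟫ + β⁻¹ * ‖fgrad x‖ ^ 2 := by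
    have h := sq_nonneg ‖β • (x - w) + fgrad x‖
    rw [norm_add_sq_real, real_inner_smul_left, norm_smul, mul_pow, Real.norm_eq_abs, sq_abs] at h
    have h' := mul_nonneg (inv_nonneg.2 hβ.le) h
    have e : β⁻¹ * (β ^ 2 * ‖x - w‖ ^ 2 + 2 * (β * ⟪x - w, fgrad x⟫) + ‖fgrad x‖ ^ 2)
        = β * ‖x - w‖ ^ 2 + 2 * ⟪x - w, fgrad x⟫ + β⁻¹ * ‖fgrad x‖ ^ 2 := by
      field_simp
    rwa [e] at h'
  have hk := mul_nonneg (mul_nonneg (sub_nonneg.2 hp') hη.le) hy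
  rw [div_eq_mul_inv]
  linarith
end

section
/- Let f_i : ℝ^d → ℝ be convex, differentiable and L_i-smooth, and set f = (1/n) Σ_{i=1}^n f_i. Let a sampling with weights p_C and nonnegative θ^i_C ≥ 0 be given, and define ℒ := (1/n) max_{i∈[n]} Σ_{j∈[n]} Σ_{C : i,j ∈ C} p_C θ^i_C θ^j_C L_j. Then for all x, y ∈ ℝ^d: E_S ‖(1/n) Σ_{i∈S} θ^i_S (∇f_i(x) − ∇f_i(y))‖² ≤ 2 ℒ (f(x) − f(y) − ⟨∇f(y), x − y⟩). -/
open scoped RealInnerProductSpace BigOperators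

section helpers
variable {E : Type*} [NormedAddCommGroup E] [InnerProductSpace ℝ E] [CompleteSpace E]

theorem aux_line {f : E → ℝ} {f' : E → E} (hg : ∀ x, HasGradientAt f (f' x) x) (x v : E) (t : ℝ) :
    HasDerivAt (fun s : ℝ => f (x + s • v)) ⟪f' (x + t • v), v⟫ t := by
  have h1 : HasDerivAt (fun s : ℝ => x + s • v) v t := by
    simpa using ((hasDerivAt_id t).smul_const v).const_add x
  have h2 := (hasGradientAt_iff_hasFDerivAt.mp (hg (x + t • v))).comp_hasDerivAt t h1
  rw [InnerProductSpace.toDual_apply_apply] at h2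
  exact h2

theorem aux_descent_s9 {f : E → ℝ} {f' : E → E} (hg : ∀ x, HasGradientAt f (f' x) x) {L : ℝ}
    (hL : 0 ≤ L) (hs : ∀ x y, ‖f' x - f' y‖ ≤ L * ‖x - y‖) (x v : E) :
    f (x + v) ≤ f x + ⟪f' x, v⟫ + L / 2 * ‖v‖ ^ 2 := by
  have hd : ∀ t : ℝ, HasDerivAt
      (fun s : ℝ => f (x + s • v) - (s * ⟪f' x, v⟫ + s ^ 2 * (L / 2 * ‖v‖ ^ 2)))
      (⟪f' (x + t • v), v⟫ - (1 * ⟪f' x, v⟫ + (2 * t) * (L / 2 * ‖v‖ ^ 2))) t := by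
    intro t
    refine (aux_line hg x v t).sub (((hasDerivAt_id t).mul_const _).add ?_)
    have := (hasDerivAt_pow 2 t).mul_const (L / 2 * ‖v‖ ^ 2)
    simpa using this
  have ha := antitoneOn_of_deriv_nonpos (convex_Icc (0:ℝ) 1)
    (fun t _ => (hd t).continuousAt.continuousWithinAt)
    (fun t _ => (hd t).differentiableAt.differentiableWithinAt) (by
      intro t ht
      rw [interior_Icc] at ht
      rw [(hd t).deriv]
      have h1 : ⟪f' (x + t • v) - f' x, v⟫ ≤ ‖f' (x + t • v) - f' x‖ * ‖v‖ :=
        real_inner_le_norm _ _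
      have h2 := hs (x + t • v) x
      rw [add_sub_cancel_left, norm_smul, Real.norm_of_nonneg ht.1.le] at h2
      have h3 := mul_le_mul_of_nonneg_right h2 (norm_nonneg v)
      rw [inner_sub_left] at h1
      nlinarith)
  have := ha (Set.left_mem_Icc.mpr zero_le_one) (Set.right_mem_Icc.mpr zero_le_one) zero_le_one
  simp at this
  linarith

theorem aux_first {f : E → ℝ} {f' : E → E} (hg : ∀ x, HasGradientAt f (f' x) x)
    (hc : ConvexOn ℝ Set.univ f) (x y : E) : 0 ≤ f x - f y - ⟪f' y, x - y⟫ := by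
  have hc' : ConvexOn ℝ Set.univ (fun s : ℝ => f (y + s • (x - y))) := by
    have := hc.comp_affineMap (AffineMap.lineMap y x : ℝ →ᵃ[ℝ] E)
    refine this.congr ?_ |>.subset (by simp) convex_univ
    intro s _
    simp [AffineMap.lineMap_apply, add_comm]
  have := hc'.le_slope_of_hasDerivAt (Set.mem_univ (0:ℝ)) (Set.mem_univ 1) zero_lt_one
    (aux_line hg y (x - y) 0)
  simp [slope_def_field] at this
  linarith

theorem aux_coco {f : E → ℝ} {f' : E → E} (hg : ∀ x, HasGradientAt f (f' x) x)
    (hc : ConvexOn ℝ Set.univ f) {L : ℝ}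
    (hL : 0 ≤ L) (hs : ∀ x y, ‖f' x - f' y‖ ≤ L * ‖x - y‖) (x y : E) :
    ‖f' x - f' y‖ ^ 2 ≤ 2 * L * (f x - f y - ⟪f' y, x - y⟫) := by
  rcases hL.eq_or_lt with h0 | hpos
  · subst h0
    have := hs x y
    rw [zero_mul] at this
    rw [le_antisymm this (norm_nonneg _)]; simp
  · set g := f' x - f' y with hgdef
    have h1 := aux_descent_s9 hg hL hs x (-(L⁻¹ • g))
    have h2 := aux_first hg hc (x + -(L⁻¹ • g)) y
    have e : x + -(L⁻¹ • g) - y = (x - y) - L⁻¹ • g := by abel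
    rw [e, inner_sub_right, inner_smul_right] at h2
    rw [norm_neg, norm_smul, inner_neg_right, inner_smul_right, Real.norm_of_nonneg (by positivity)] at h1
    have h3 : ⟪f' x, g⟫ - ⟪f' y, g⟫ = ‖g‖ ^ 2 := by
      rw [← inner_sub_left, ← hgdef, real_inner_self_eq_norm_sq]
    have h4 : L / 2 * (L⁻¹ * ‖g‖) ^ 2 = L⁻¹ * ‖g‖ ^ 2 / 2 := by field_simp
    have h5 : L⁻¹ * ⟪f' x, g⟫ - L⁻¹ * ⟪f' y, g⟫ = L⁻¹ * ‖g‖ ^ 2 := by rw [← h3]; ring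
    have h6 : L⁻¹ * ‖g‖ ^ 2 / 2 ≤ f x - f y - ⟪f' y, x - y⟫ := by linarith
    calc ‖g‖ ^ 2 = 2 * L * (L⁻¹ * ‖g‖ ^ 2 / 2) := by field_simp
      _ ≤ _ := by gcongr

theorem aux_amgm {u v : E} {a b c d : ℝ} (ha : 0 ≤ a) (hb : 0 ≤ b) (hc : 0 ≤ c) (hd : 0 ≤ d)
    (hu : ‖u‖ ^ 2 ≤ 2 * a * b) (hv : ‖v‖ ^ 2 ≤ 2 * c * d) : ⟪u, v⟫ ≤ c * b + a * d := by
  refine (real_inner_le_norm u v).trans (abs_le_of_sq_le_sq' ?_ (by positivity)).2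
  rw [mul_pow]
  calc ‖u‖ ^ 2 * ‖v‖ ^ 2 ≤ (2 * a * b) * (2 * c * d) := by gcongr
    _ ≤ _ := by nlinarith [sq_nonneg (c * b - a * d)]

theorem aux_C {ι : Type*} (C : Finset ι) (θ L D : ι → ℝ) (g : ι → E) (hθ : ∀ i, 0 ≤ θ i)
    (hL : ∀ i, 0 ≤ L i) (hD : ∀ i, 0 ≤ D i) (hg : ∀ i, ‖g i‖ ^ 2 ≤ 2 * L i * D i) :
    ‖∑ i ∈ C, θ i • g i‖ ^ 2 ≤ 2 * ∑ i ∈ C, ∑ j ∈ C, θ i * θ j * L j * D i := by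
  have e : ∑ i ∈ C, ∑ j ∈ C, θ i * θ j * L i * D j = ∑ i ∈ C, ∑ j ∈ C, θ i * θ j * L j * D i := by
    rw [Finset.sum_comm]
    refine Finset.sum_congr rfl fun i _ => Finset.sum_congr rfl fun j _ => by ring
  rw [two_mul]
  nth_rewrite 2 [← e]
  rw [← real_inner_self_eq_norm_sq, sum_inner, ← Finset.sum_add_distrib]
  refine Finset.sum_le_sum fun i _ => ?_
  rw [inner_sum, ← Finset.sum_add_distrib]
  refine Finset.sum_le_sum fun j _ => ?_
  rw [real_inner_smul_left, inner_smul_right]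
  have := mul_le_mul_of_nonneg_left (aux_amgm (hL i) (hD i) (hL j) (hD j) (hg i) (hg j))
    (mul_nonneg (hθ i) (hθ j))
  linarith
end helpers

/-- Lemma F.1(i) of the paper: general expected smoothness bound,
with `ℒ = (1/n) maxᵢ Σⱼ Σ_{C : i,j ∈ C} p_C θ^i_C θ^j_C L_j`. -/
theorem expected_smoothness_arbitrary_sampling
    {d n : ℕ} (hn : 0 < n)
    (f : Fin n → EuclideanSpace ℝ (Fin d) → ℝ)
    (f' : Fin n → EuclideanSpace ℝ (Fin d) → EuclideanSpace ℝ (Fin d))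
    (hgrad : ∀ i x, HasGradientAt (f i) (f' i x) x)
    (L : Fin n → ℝ) (hL0 : ∀ i, 0 ≤ L i)
    (hconv : ∀ i, ConvexOn ℝ Set.univ (f i))
    (hsmooth : ∀ i, LipschitzWith (Real.toNNReal (L i)) (f' i))
    (fbar : EuclideanSpace ℝ (Fin d) → ℝ)
    (hfbar : ∀ u, fbar u = (n : ℝ)⁻¹ * ∑ i, f i u)
    (fgrad : EuclideanSpace ℝ (Fin d) → EuclideanSpace ℝ (Fin d))
    (hfgrad : ∀ u, fgrad u = (n : ℝ)⁻¹ • ∑ i, f' i u)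
    (pC : Finset (Fin n) → ℝ) (hpC : ∀ C, 0 ≤ pC C) (hpCsum : ∑ C, pC C = 1)
    (θ : Finset (Fin n) → Fin n → ℝ) (hθ : ∀ C i, 0 ≤ θ C i)
    (ℒ : ℝ)
    (hℒ : ℒ = (n : ℝ)⁻¹ *
        Finset.univ.sup' (Finset.univ_nonempty_iff.mpr (Fin.pos_iff_nonempty.mp hn))
          (fun i => ∑ j, ∑ C ∈ Finset.univ.filter (fun C => i ∈ C ∧ j ∈ C),
            pC C * θ C i * θ C j * L j)) :
    ∀ x y : EuclideanSpace ℝ (Fin d),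
      ∑ C, pC C * ‖(n : ℝ)⁻¹ • ∑ i ∈ C, θ C i • (f' i x - f' i y)‖ ^ 2
        ≤ 2 * ℒ * (fbar x - fbar y - ⟪fgrad y, x - y⟫) := by
  intro x y
  set D : Fin n → ℝ := fun i => f i x - f i y - ⟪f' i y, x - y⟫ with hDdef
  have hD : ∀ i, 0 ≤ D i := fun i => aux_first (hgrad i) (hconv i) x y
  have hg : ∀ i, ‖f' i x - f' i y‖ ^ 2 ≤ 2 * L i * D i := fun i =>
    aux_coco (hgrad i) (hconv i) (hL0 i) (fun a b => by
      have := (hsmooth i).dist_le_mul a b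
      rwa [dist_eq_norm, dist_eq_norm, Real.coe_toNNReal _ (hL0 i)] at this) x y
  have hbar : fbar x - fbar y - ⟪fgrad y, x - y⟫ = (n : ℝ)⁻¹ * ∑ i, D i := by
    rw [hfbar, hfbar, hfgrad, real_inner_smul_left, sum_inner, hDdef]
    simp only [Finset.sum_sub_distrib]
    ring
  rw [hbar]
  set M := Finset.univ.sup' (Finset.univ_nonempty_iff.mpr (Fin.pos_iff_nonempty.mp hn))
          (fun i => ∑ j, ∑ C ∈ Finset.univ.filter (fun C => i ∈ C ∧ j ∈ C),
            pC C * θ C i * θ C j * L j) with hM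
  have hswap : ∑ C, pC C * ∑ i ∈ C, ∑ j ∈ C, θ C i * θ C j * L j * D i
      = ∑ i, (∑ j, ∑ C ∈ Finset.univ.filter (fun C => i ∈ C ∧ j ∈ C),
            pC C * θ C i * θ C j * L j) * D i := by
    have e1 : ∀ C : Finset (Fin n), pC C * ∑ i ∈ C, ∑ j ∈ C, θ C i * θ C j * L j * D i
        = ∑ i, ∑ j, if i ∈ C ∧ j ∈ C then pC C * θ C i * θ C j * L j * D i else 0 := by
      intro C
      simp only [ite_and, Finset.sum_ite_irrel, Finset.sum_const_zero, Finset.sum_ite_mem,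
        Finset.univ_inter, Finset.mul_sum]
      refine Finset.sum_congr rfl fun i _ => Finset.sum_congr rfl fun j _ => by ring
    simp_rw [e1]
    rw [Finset.sum_comm]
    refine Finset.sum_congr rfl fun i _ => ?_
    rw [Finset.sum_comm, Finset.sum_mul]
    refine Finset.sum_congr rfl fun j _ => ?_
    rw [Finset.sum_mul, Finset.sum_filter]
  calc ∑ C, pC C * ‖(n : ℝ)⁻¹ • ∑ i ∈ C, θ C i • (f' i x - f' i y)‖ ^ 2
      ≤ ∑ C, pC C * ((n : ℝ)⁻¹ ^ 2 * (2 * ∑ i ∈ C, ∑ j ∈ C, θ C i * θ C j * L j * D i)) := by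
        refine Finset.sum_le_sum fun C _ => mul_le_mul_of_nonneg_left ?_ (hpC C)
        rw [norm_smul, mul_pow, Real.norm_of_nonneg (by positivity)]
        exact mul_le_mul_of_nonneg_left (aux_C C (θ C) L D _ (hθ C) hL0 hD hg) (by positivity)
    _ = (n : ℝ)⁻¹ ^ 2 * 2 * ∑ C, pC C * ∑ i ∈ C, ∑ j ∈ C, θ C i * θ C j * L j * D i := by
        rw [Finset.mul_sum]
        exact Finset.sum_congr rfl fun C _ => by ring
    _ ≤ (n : ℝ)⁻¹ ^ 2 * 2 * ∑ i, M * D i := by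
        rw [hswap]
        refine mul_le_mul_of_nonneg_left (Finset.sum_le_sum fun i _ =>
          mul_le_mul_of_nonneg_right ?_ (hD i)) (by positivity)
        rw [hM]
        exact Finset.le_sup' (fun i => ∑ j, ∑ C ∈ Finset.univ.filter (fun C => i ∈ C ∧ j ∈ C),
            pC C * θ C i * θ C j * L j) (Finset.mem_univ i)
    _ = 2 * ℒ * ((n : ℝ)⁻¹ * ∑ i, D i) := by
        rw [hℒ, ← Finset.mul_sum]; ring
end

section
/- Let f_i : ℝ^d → ℝ be convex, differentiable and L_i-smooth, and let f = (1/n) Σ_{i=1}^n f_i be convex and L_f-smooth. Let S be a group sampling with marginals p_i ∈ (0,1], groups C_1,…,C_t, and isolated index set 𝓘. Then for all x, y ∈ ℝ^d: E_S ‖(1/n) Σ_{i∈S} (1/p_i)(∇f_i(x) − ∇f_i(y))‖² ≤ 2 [ L_f + (1/n) max{ max_{i∈𝓘} (1/p_i − 1) L_i , max_{i∉𝓘} L_i/p_i } ] · (f(x) − f(y) − ⟨∇f(y), x − y⟩). -/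
open scoped RealInnerProductSpace BigOperators

section Helpers
variable {E : Type*} [NormedAddCommGroup E] [InnerProductSpace ℝ E] [CompleteSpace E]

lemma gs_line (f : E → ℝ) (f' : E → E) (hg : ∀ x, HasGradientAt f (f' x) x) (x v : E) (s : ℝ) :
    HasDerivAt (fun s : ℝ => f (x + s • v)) ⟪f' (x + s • v), v⟫ s := by
  have h1 : HasDerivAt (fun s : ℝ => x + s • v) v s := by
    simpa using ((hasDerivAt_id s).smul_const v).const_add x
  have h2 := (hg (x + s • v)).hasFDerivAt.comp_hasDerivAt s h1
  simp only [InnerProductSpace.toDual_apply_apply] at h2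
  exact h2

lemma gs_descent (f : E → ℝ) (f' : E → E) (hg : ∀ x, HasGradientAt f (f' x) x) (L : ℝ)
    (hL : 0 ≤ L) (hs : LipschitzWith (Real.toNNReal L) f') (x v : E) :
    f (x + v) ≤ f x + ⟪f' x, v⟫ + L / 2 * ‖v‖ ^ 2 := by
  have hd : ∀ s : ℝ, HasDerivAt (fun s : ℝ => f (x + s • v) - s * ⟪f' x, v⟫ - L / 2 * ‖v‖ ^ 2 * s ^ 2)
      (⟪f' (x + s • v), v⟫ - ⟪f' x, v⟫ - L * ‖v‖ ^ 2 * s) s := by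
    intro s
    have h := ((gs_line f f' hg x v s).sub ((hasDerivAt_id s).mul_const ⟪f' x, v⟫)).sub
      (((hasDerivAt_id s).pow 2).const_mul (L / 2 * ‖v‖ ^ 2))
    refine h.congr_deriv ?_
    simp
    ring
  have ha : AntitoneOn (fun s : ℝ => f (x + s • v) - s * ⟪f' x, v⟫ - L / 2 * ‖v‖ ^ 2 * s ^ 2)
      (Set.Icc 0 1) := by
    apply antitoneOn_of_deriv_nonpos (convex_Icc 0 1)
    · exact fun s _ => (hd s).continuousAt.continuousWithinAt
    · exact fun s _ => (hd s).differentiableAt.differentiableWithinAt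
    · intro s hs'
      rw [interior_Icc] at hs'
      rw [(hd s).deriv, ← inner_sub_left]
      have h1 := real_inner_le_norm (f' (x + s • v) - f' x) v
      have h2 := hs.dist_le_mul (x + s • v) x
      rw [dist_eq_norm, dist_eq_norm, Real.coe_toNNReal _ hL, add_sub_cancel_left, norm_smul,
        Real.norm_eq_abs, abs_of_pos hs'.1] at h2
      have h3 := mul_le_mul_of_nonneg_right h2 (norm_nonneg v)
      nlinarith
  have := ha (Set.left_mem_Icc.2 zero_le_one) (Set.right_mem_Icc.2 zero_le_one) zero_le_one
  simp at this
  linarith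

lemma gs_first (f : E → ℝ) (f' : E → E) (hg : ∀ x, HasGradientAt f (f' x) x)
    (hc : ConvexOn ℝ Set.univ f) (y z : E) : f y + ⟪f' y, z - y⟫ ≤ f z := by
  have hc' : ConvexOn ℝ Set.univ (fun s : ℝ => f (y + s • (z - y))) := by
    have := hc.comp_affineMap (AffineMap.lineMap y z : ℝ →ᵃ[ℝ] E)
    have e : (fun s : ℝ => f (y + s • (z - y))) = f ∘ (AffineMap.lineMap y z : ℝ →ᵃ[ℝ] E) := by
      funext s
      simp [AffineMap.lineMap_apply, add_comm]
    rw [e]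
    exact this
  have h := hc'.le_slope_of_hasDerivAt (Set.mem_univ 0) (Set.mem_univ 1) zero_lt_one
    (gs_line f f' hg y (z - y) 0)
  simp [slope_def_field] at h
  linarith

lemma gs_coco (f : E → ℝ) (f' : E → E) (hg : ∀ x, HasGradientAt f (f' x) x) (L : ℝ)
    (hL : 0 ≤ L) (hs : LipschitzWith (Real.toNNReal L) f') (hc : ConvexOn ℝ Set.univ f) (x y : E) :
    ‖f' x - f' y‖ ^ 2 ≤ 2 * L * (f x - f y - ⟪f' y, x - y⟫) := by
  rcases hL.eq_or_lt with h0 | hpos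
  · have h2 := hs.dist_le_mul x y
    rw [dist_eq_norm, Real.coe_toNNReal _ hL, ← h0, zero_mul] at h2
    have : ‖f' x - f' y‖ = 0 := le_antisymm h2 (norm_nonneg _)
    rw [this, ← h0]; simp
  · have h1 := gs_descent f f' hg L hL hs x (-(L⁻¹ • (f' x - f' y)))
    have h2 := gs_first f f' hg hc y (x + -(L⁻¹ • (f' x - f' y)))
    have e1 : ⟪f' y, x + -(L⁻¹ • (f' x - f' y)) - y⟫
        = ⟪f' y, x - y⟫ - L⁻¹ * ⟪f' y, f' x - f' y⟫ := by
      rw [show x + -(L⁻¹ • (f' x - f' y)) - y = (x - y) - L⁻¹ • (f' x - f' y) by abel,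
        inner_sub_right, inner_smul_right]
    rw [e1] at h2
    rw [inner_neg_right, inner_smul_right, norm_neg, norm_smul, Real.norm_eq_abs,
      abs_of_pos (inv_pos.2 hpos)] at h1
    have e2 : ⟪f' x, f' x - f' y⟫ - ⟪f' y, f' x - f' y⟫ = ‖f' x - f' y‖ ^ 2 := by
      rw [← inner_sub_left, real_inner_self_eq_norm_sq]
    have e3 : L / 2 * (L⁻¹ * ‖f' x - f' y‖) ^ 2 = L⁻¹ * ‖f' x - f' y‖ ^ 2 / 2 := by
      field_simp
    rw [e3] at h1
    have e4 : L⁻¹ * ⟪f' x, f' x - f' y⟫ - L⁻¹ * ⟪f' y, f' x - f' y⟫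
        = L⁻¹ * ‖f' x - f' y‖ ^ 2 := by rw [← e2]; ring
    have h5 : L⁻¹ * ‖f' x - f' y‖ ^ 2 ≤ 2 * (f x - f y - ⟪f' y, x - y⟫) := by linarith
    have h6 := mul_le_mul_of_nonneg_left h5 hL
    rw [← mul_assoc, mul_inv_cancel₀ hpos.ne', one_mul] at h6
    linarith

lemma gs_normsq {ι : Type*} (s : Finset ι) (b : ι → E) :
    ‖∑ i ∈ s, b i‖ ^ 2 = ∑ i ∈ s, ∑ j ∈ s, ⟪b i, b j⟫ := by
  rw [← real_inner_self_eq_norm_sq, sum_inner]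
  simp_rw [inner_sum]

lemma gs_quad {n t : ℕ} (a : Fin n → E) (p : Fin n → ℝ) (hp0 : ∀ i, 0 < p i)
    (G : Fin t → Finset (Fin n))
    (hGdisj : ∀ j k, j ≠ k → Disjoint (G j) (G k))
    (hGcover : ∀ i : Fin n, ∃ j, i ∈ G j)
    (pC : Finset (Fin n) → ℝ)
    (hmarg : ∀ i, ∑ C ∈ Finset.univ.filter (fun C => i ∈ C), pC C = p i)
    (hsame : ∀ i j : Fin n, i ≠ j → (∃ k, i ∈ G k ∧ j ∈ G k) →
      ∑ C ∈ Finset.univ.filter (fun C => i ∈ C ∧ j ∈ C), pC C = 0)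
    (hdiff : ∀ i j : Fin n, ¬ (∃ k, i ∈ G k ∧ j ∈ G k) →
      ∑ C ∈ Finset.univ.filter (fun C => i ∈ C ∧ j ∈ C), pC C = p i * p j)
    (w : Fin n → ℝ) (hw1 : ∀ i, (∃ k, G k = {i}) → w i = 1 / p i - 1)
    (hw2 : ∀ i, (¬ ∃ k, G k = {i}) → w i = 1 / p i) :
    ∑ C, pC C * ‖∑ i ∈ C, (p i)⁻¹ • a i‖ ^ 2 ≤ ‖∑ i, a i‖ ^ 2 + ∑ i, w i * ‖a i‖ ^ 2 := by
  classical
  choose g hg using hGcover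
  have huniq : ∀ i k, i ∈ G k ↔ g i = k := by
    intro i k
    constructor
    · intro h
      by_contra hne
      exact Finset.disjoint_left.1 (hGdisj _ _ hne) (hg i) h
    · rintro rfl; exact hg i
  have hsm : ∀ i j, (∃ k, i ∈ G k ∧ j ∈ G k) ↔ g i = g j := by
    intro i j
    simp only [huniq]
    constructor
    · rintro ⟨k, h1, h2⟩; rw [h1, h2]
    · intro h; exact ⟨g j, h, rfl⟩
  have hX : ∑ C, pC C * ‖∑ i ∈ C, (p i)⁻¹ • a i‖ ^ 2
      = ∑ i, ∑ j, (∑ C ∈ Finset.univ.filter (fun C => i ∈ C ∧ j ∈ C), pC C)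
          * ((p i)⁻¹ * (p j)⁻¹ * ⟪a i, a j⟫) := by
    have : ∀ C : Finset (Fin n), pC C * ‖∑ i ∈ C, (p i)⁻¹ • a i‖ ^ 2
        = ∑ i, ∑ j, (if i ∈ C ∧ j ∈ C then pC C else 0) * ((p i)⁻¹ * (p j)⁻¹ * ⟪a i, a j⟫) := by
      intro C
      rw [gs_normsq, Finset.mul_sum, ← Finset.sum_filter_add_sum_filter_not Finset.univ (· ∈ C)]
      rw [Finset.sum_eq_zero (s := Finset.univ.filter (· ∉ C)), add_zero]
      · rw [Finset.filter_mem_eq_inter, Finset.univ_inter]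
        refine Finset.sum_congr rfl fun i hi => ?_
        rw [Finset.mul_sum]
        simp only [hi, true_and, ite_mul, zero_mul]
        rw [← Finset.sum_filter, Finset.filter_mem_eq_inter, Finset.univ_inter]
        refine Finset.sum_congr rfl fun j hj => ?_
        rw [inner_smul_left, inner_smul_right]
        simp [mul_assoc]
      · intro i hi
        simp [(Finset.mem_filter.1 hi).2]
    simp_rw [this]
    rw [Finset.sum_comm]
    refine Finset.sum_congr rfl fun i _ => ?_
    rw [Finset.sum_comm]
    refine Finset.sum_congr rfl fun j _ => ?_
    rw [← Finset.sum_mul, Finset.sum_filter]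
  have hT : ∀ i j, (∑ C ∈ Finset.univ.filter (fun C => i ∈ C ∧ j ∈ C), pC C)
          * ((p i)⁻¹ * (p j)⁻¹ * ⟪a i, a j⟫)
      = ⟪a i, a j⟫ + (if i = j then (1 / p i) * ⟪a i, a j⟫ else 0)
        - (if g i = g j then ⟪a i, a j⟫ else 0) := by
    intro i j
    have hi := (hp0 i).ne'
    have hj := (hp0 j).ne'
    by_cases hij : i = j
    · subst hij
      simp only [and_self, hmarg, if_true]
      field_simp
      ring
    · by_cases hs : g i = g j
      · rw [hsame i j hij ((hsm i j).2 hs)]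
        simp [hij, hs]
      · rw [hdiff i j (fun h => hs ((hsm i j).1 h))]
        simp only [hij, hs, if_false]
        field_simp
        ring
  have hB : ∑ i, ∑ j, (if g i = g j then ⟪a i, a j⟫ else 0)
      = ∑ k, ‖∑ i ∈ Finset.univ.filter (fun i => g i = k), a i‖ ^ 2 := by
    rw [← Finset.sum_fiberwise Finset.univ g]
    refine Finset.sum_congr rfl fun k _ => ?_
    rw [gs_normsq]
    refine Finset.sum_congr rfl fun i hi => ?_
    rw [← Finset.sum_filter, (Finset.mem_filter.1 hi).2]
    simp only [eq_comm]
  have hI : ∑ i, (if ∃ k, G k = {i} then ‖a i‖ ^ 2 else 0)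
      ≤ ∑ k, ‖∑ i ∈ Finset.univ.filter (fun i => g i = k), a i‖ ^ 2 := by
    rw [← Finset.sum_fiberwise Finset.univ g]
    refine Finset.sum_le_sum fun k _ => ?_
    have hf : Finset.univ.filter (fun i => g i = k) = G k := by
      ext i; simp [huniq]
    rw [hf]
    by_cases hk : ∃ i, G k = {i}
    · obtain ⟨i, hi⟩ := hk
      rw [hi, Finset.sum_singleton, Finset.sum_singleton, if_pos ⟨k, hi⟩]
    · rw [Finset.sum_eq_zero]
      · positivity
      · intro i hi
        rw [if_neg]
        rintro ⟨k', hk'⟩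
        have h1 := (huniq i k).1 hi
        have h2 := (huniq i k').1 (by simp [hk'])
        exact hk ⟨i, by rw [← h1, h2, hk']⟩
  have hW : ∑ i, w i * ‖a i‖ ^ 2 = ∑ i, 1 / p i * ‖a i‖ ^ 2
      - ∑ i, (if ∃ k, G k = {i} then ‖a i‖ ^ 2 else 0) := by
    rw [← Finset.sum_sub_distrib]
    refine Finset.sum_congr rfl fun i _ => ?_
    by_cases h : ∃ k, G k = {i}
    · rw [hw1 i h, if_pos h]; ring
    · rw [hw2 i h, if_neg h]; ring
  rw [hX]
  simp_rw [hT, Finset.sum_sub_distrib, Finset.sum_add_distrib]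
  rw [hB, ← gs_normsq, hW]
  simp only [Finset.sum_ite_eq, Finset.mem_univ, if_true, real_inner_self_eq_norm_sq]
  linarith

end Helpers



/-- Lemma F.2(ii) of the paper: expected smoothness constant ℒ₁ for
group sampling with `θ^i_S = 1/p_i`.  An index `i` is isolated if its group is `{i}`;
the empty supremum is interpreted (as in `Real.sSup`) as `0`. -/
theorem L1_group_sampling
    {d n t : ℕ}
    (f : Fin n → EuclideanSpace ℝ (Fin d) → ℝ)
    (f' : Fin n → EuclideanSpace ℝ (Fin d) → EuclideanSpace ℝ (Fin d))
    (hgrad : ∀ i x, HasGradientAt (f i) (f' i x) x)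
    (L : Fin n → ℝ) (hL0 : ∀ i, 0 ≤ L i)
    (hconv : ∀ i, ConvexOn ℝ Set.univ (f i))
    (hsmooth : ∀ i, LipschitzWith (Real.toNNReal (L i)) (f' i))
    (fbar : EuclideanSpace ℝ (Fin d) → ℝ)
    (hfbar : ∀ u, fbar u = (n : ℝ)⁻¹ * ∑ i, f i u)
    (fgrad : EuclideanSpace ℝ (Fin d) → EuclideanSpace ℝ (Fin d))
    (hfgrad : ∀ u, fgrad u = (n : ℝ)⁻¹ • ∑ i, f' i u)
    (Lf : ℝ) (hLf0 : 0 ≤ Lf)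
    (hfconv : ConvexOn ℝ Set.univ fbar)
    (hfsmooth : LipschitzWith (Real.toNNReal Lf) fgrad)
    -- marginals and groups
    (p : Fin n → ℝ) (hp0 : ∀ i, 0 < p i) (hp1 : ∀ i, p i ≤ 1)
    (G : Fin t → Finset (Fin n))
    (hGdisj : ∀ j k, j ≠ k → Disjoint (G j) (G k))
    (hGcover : ∀ i : Fin n, ∃ j, i ∈ G j)
    (hGsum : ∀ j, ∑ i ∈ G j, p i ≤ 1)
    -- the group sampling distribution
    (pC : Finset (Fin n) → ℝ) (hpC : ∀ C, 0 ≤ pC C) (hpCsum : ∑ C, pC C = 1)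
    (hmarg : ∀ i, ∑ C ∈ Finset.univ.filter (fun C => i ∈ C), pC C = p i)
    (hsame : ∀ i j : Fin n, i ≠ j → (∃ k, i ∈ G k ∧ j ∈ G k) →
      ∑ C ∈ Finset.univ.filter (fun C => i ∈ C ∧ j ∈ C), pC C = 0)
    (hdiff : ∀ i j : Fin n, ¬ (∃ k, i ∈ G k ∧ j ∈ G k) →
      ∑ C ∈ Finset.univ.filter (fun C => i ∈ C ∧ j ∈ C), pC C = p i * p j)
    (x y : EuclideanSpace ℝ (Fin d)) :
    ∑ C, pC C * ‖(n : ℝ)⁻¹ • ∑ i ∈ C, (p i)⁻¹ • (f' i x - f' i y)‖ ^ 2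
      ≤ 2 * (Lf + (n : ℝ)⁻¹ * max
            (sSup ((fun i => (1 / p i - 1) * L i) '' {i : Fin n | ∃ k, G k = {i}}))
            (sSup ((fun i => L i / p i) '' {i : Fin n | ¬ ∃ k, G k = {i}})))
          * (fbar x - fbar y - ⟪fgrad y, x - y⟫) := by
  classical
  set c : ℝ := (n : ℝ)⁻¹ with hc
  have hc0 : 0 ≤ c := by positivity
  set M : ℝ := max
            (sSup ((fun i => (1 / p i - 1) * L i) '' {i : Fin n | ∃ k, G k = {i}}))
            (sSup ((fun i => L i / p i) '' {i : Fin n | ¬ ∃ k, G k = {i}})) with hM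
  let w : Fin n → ℝ := fun i => if ∃ k, G k = {i} then 1 / p i - 1 else 1 / p i
  have hw1 : ∀ i, (∃ k, G k = {i}) → w i = 1 / p i - 1 := fun i h => if_pos h
  have hw2 : ∀ i, (¬ ∃ k, G k = {i}) → w i = 1 / p i := fun i h => if_neg h
  have hw0 : ∀ i, 0 ≤ w i := by
    intro i
    by_cases h : ∃ k, G k = {i}
    · rw [hw1 i h]
      have := one_le_one_div (hp0 i) (hp1 i)
      linarith
    · rw [hw2 i h]
      exact (one_div_pos.2 (hp0 i)).le
  have hwM : ∀ i, w i * L i ≤ M := by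
    intro i
    by_cases h : ∃ k, G k = {i}
    · rw [hw1 i h]
      exact (le_csSup (Set.toFinite _).bddAbove
        (Set.mem_image_of_mem (fun i => (1 / p i - 1) * L i) h)).trans (le_max_left _ _)
    · rw [hw2 i h, one_div, mul_comm, ← div_eq_mul_inv]
      exact (le_csSup (Set.toFinite _).bddAbove
        (Set.mem_image_of_mem (fun i => L i / p i) h)).trans (le_max_right _ _)
  have hq := gs_quad (fun i => f' i x - f' i y) p hp0 G hGdisj hGcover pC hmarg hsame hdiff w hw1 hw2
  have hgb : ∀ u, HasGradientAt fbar (fgrad u) u := by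
    intro u
    have h1 : HasFDerivAt (fun u => c * ∑ i, f i u)
        (c • ∑ i, InnerProductSpace.toDual ℝ _ (f' i u)) u :=
      (HasFDerivAt.fun_sum fun i _ => (hgrad i u).hasFDerivAt).const_mul c
    rw [hasGradientAt_iff_hasFDerivAt, hfgrad u, funext hfbar]
    refine h1.congr_fderiv ?_
    ext v
    simp only [ContinuousLinearMap.smul_apply, ContinuousLinearMap.sum_apply,
      InnerProductSpace.toDual_apply_apply, real_inner_smul_left, sum_inner, smul_eq_mul]
  have hbar := gs_coco fbar fgrad hgb Lf hLf0 hfsmooth hfconv x y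
  have hbd : fgrad x - fgrad y = c • ∑ i, (f' i x - f' i y) := by
    rw [hfgrad, hfgrad, ← smul_sub, Finset.sum_sub_distrib]
  have hD : fbar x - fbar y - ⟪fgrad y, x - y⟫
      = c * ∑ i, (f i x - f i y - ⟪f' i y, x - y⟫) := by
    rw [hfbar, hfbar, hfgrad, real_inner_smul_left, sum_inner, Finset.sum_sub_distrib,
      Finset.sum_sub_distrib]
    ring
  have hDi : ∀ i, 0 ≤ f i x - f i y - ⟪f' i y, x - y⟫ := by
    intro i
    have := gs_first (f i) (f' i) (hgrad i) (hconv i) y x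
    linarith
  have hsum : ∑ i, w i * ‖f' i x - f' i y‖ ^ 2
      ≤ 2 * M * ∑ i, (f i x - f i y - ⟪f' i y, x - y⟫) := by
    rw [Finset.mul_sum]
    refine Finset.sum_le_sum fun i _ => ?_
    have h1 := mul_le_mul_of_nonneg_left
      (gs_coco (f i) (f' i) (hgrad i) (L i) (hL0 i) (hsmooth i) (hconv i) x y) (hw0 i)
    have h2 := mul_le_mul_of_nonneg_right (hwM i) (hDi i)
    linarith
  have hlhs : ∑ C, pC C * ‖c • ∑ i ∈ C, (p i)⁻¹ • (f' i x - f' i y)‖ ^ 2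
      = c ^ 2 * ∑ C, pC C * ‖∑ i ∈ C, (p i)⁻¹ • (f' i x - f' i y)‖ ^ 2 := by
    rw [Finset.mul_sum]
    refine Finset.sum_congr rfl fun C _ => ?_
    rw [norm_smul, mul_pow, Real.norm_eq_abs, sq_abs]
    ring
  rw [hlhs]
  rw [hbd, norm_smul, mul_pow, Real.norm_eq_abs, sq_abs] at hbar
  have h1 := mul_le_mul_of_nonneg_left hq (sq_nonneg c)
  have h2 := mul_le_mul_of_nonneg_left hsum (sq_nonneg c)
  have h3 : c ^ 2 * (2 * M * ∑ i, (f i x - f i y - ⟪f' i y, x - y⟫))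
      = 2 * (c * M) * (fbar x - fbar y - ⟪fgrad y, x - y⟫) := by
    rw [hD]; ring
  rw [h3] at h2
  rw [mul_add] at h1
  linarith
end
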